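/- For every θ ≥ 2 and every choice of constants in the Harnack assumptions there exist c, C > 0 such that: for every finite vertex-transitive graph Γ = (V,E) whose simple random walk kernel K (with uniform stationary measure π) satisfies the Harnack assumptions with parameter θ and those constants, the lamplighter random walk driven by K^⋄ on Γ^⋄ = ℤ_2 ≀ Γ has relaxation time t_rel(Γ^⋄) satisfying c·S ≤ t_rel(Γ^⋄) ≤ C·S, where S = max_{x ∈ V} Σ_{n integer, 0 ≤ n ≤ 2D^θ} 1/V(x, n^{1/θ}), D is the diameter of Γ and V(x,r) = π(B(x,r)). -/

import Mathlib

open Finset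
open scoped Classical

variable {V : Type*} [Fintype V] [DecidableEq V]

/-- `matpow K n` is the `n`-th matrix power of the kernel `K`. -/
noncomputable def matpow (K : V → V → ℝ) : ℕ → V → V → ℝ
  | 0 => fun x y => if x = y then (1 : ℝ) else 0
  | n + 1 => fun x y => ∑ z, K x z * matpow K n z y

/-- `(Γ, K, π)` is a Markov kernel: `G` is a connected (simple) graph on the finite vertex
set `V`, `K` is a stochastic kernel, irreducible, reversible with respect to the probability
measure `pi`, positive on edges and vanishing off edges (apart from the diagonal). -/
def IsMarkovKernel (G : SimpleGraph V) (K : V → V → ℝ) (pi : V → ℝ) : Prop :=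
  G.Connected ∧
  (∀ x y, 0 ≤ K x y) ∧ (∀ x, ∑ y, K x y = 1) ∧
  (∀ x, 0 < pi x) ∧ (∑ x, pi x = 1) ∧
  (∀ x y, pi x * K x y = pi y * K y x) ∧
  (∀ x y, G.Adj x y → 0 < K x y) ∧
  (∀ x y, x ≠ y → ¬ G.Adj x y → K x y = 0) ∧
  (∀ x y, ∃ n, 0 < matpow K n x y)

/-- Aperiodicity of an irreducible finite kernel, via primitivity. -/
def Aperiodic (K : V → V → ℝ) : Prop :=
  ∃ N : ℕ, ∀ n ≥ N, ∀ x y, 0 < matpow K n x y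

/-- `K` is lazy if `K(x,x) ≥ 1/2` for all `x`. -/
def Lazy (K : V → V → ℝ) : Prop := ∀ x, (1 : ℝ) / 2 ≤ K x x

/-- The closed ball `B(x,r)` for the graph distance. -/
noncomputable def gball (G : SimpleGraph V) (x : V) (r : ℝ) : Finset V :=
  univ.filter fun y => (G.dist x y : ℝ) ≤ r

/-- The volume `V(x,r) = π(B(x,r))`. -/
noncomputable def vol (G : SimpleGraph V) (pi : V → ℝ) (x : V) (r : ℝ) : ℝ :=
  ∑ y ∈ gball G x r, pi y

/-- The diameter of the graph `G`. -/
noncomputable def gdiam (G : SimpleGraph V) : ℕ :=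
  univ.sup fun x => univ.sup fun y => G.dist x y

/-- The normalized kernel `k^n(x,y) = K^n(x,y)/π(y)`. -/
noncomputable def knorm (K : V → V → ℝ) (pi : V → ℝ) (n : ℕ) (x y : V) : ℝ :=
  matpow K n x y / pi y

/-- The normalized Green function `𝒢(x,y) = ∑_{n≥0} (k^n(x,y) - 1)`. -/
noncomputable def green (K : V → V → ℝ) (pi : V → ℝ) (x y : V) : ℝ :=
  ∑' n : ℕ, (knorm K pi n x y - 1)

/-- `avoid K y n x = P_x(X_0 ≠ y, …, X_n ≠ y) = P_x(τ_y > n)`. -/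
noncomputable def avoid (K : V → V → ℝ) (y : V) : ℕ → V → ℝ
  | 0 => fun x => if x = y then 0 else 1
  | n + 1 => fun x => if x = y then 0 else ∑ z, K x z * avoid K y n z

/-- The expected hitting time `H(x,y) = E_x[τ_y] = ∑_{n≥0} P_x(τ_y > n)`. -/
noncomputable def hit (K : V → V → ℝ) (x y : V) : ℝ := ∑' n : ℕ, avoid K y n x

/-- `P_x(d(x, X_s) > R)` for the chain driven by `K` started at `x`. -/
noncomputable def probGt (G : SimpleGraph V) (K : V → V → ℝ) (x : V) (s : ℕ) (R : ℝ) : ℝ :=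
  ∑ y ∈ univ.filter (fun y => R < (G.dist x y : ℝ)), matpow K s x y

/-- The probability that the chain driven by `K`, started at `x`, produces a trajectory
`(X_0, …, X_t)` belonging to the event `A`. -/
noncomputable def pathProb (K : V → V → ℝ) (x : V) (t : ℕ)
    (A : (Fin (t + 1) → V) → Prop) : ℝ :=
  ∑ p ∈ univ.filter (fun p : Fin (t + 1) → V => p 0 = x ∧ A p),
    ∏ i : Fin t, K (p i.castSucc) (p i.succ)

/-- Condition (E): ellipticity with constant `p0`. -/
def CondE (G : SimpleGraph V) (K : V → V → ℝ) (p0 : ℝ) : Prop :=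
  ∀ x y, G.Adj x y → p0 ≤ K x y

/-- Condition (VD): volume doubling with constant `CD`. -/
def CondVD (G : SimpleGraph V) (pi : V → ℝ) (CD : ℝ) : Prop :=
  ∀ x : V, ∀ r : ℝ, 0 < r → vol G pi x (2 * r) ≤ CD * vol G pi x r

/-- The `π`-average of `f` over the ball `B(x,r)`. -/
noncomputable def ballAvg (G : SimpleGraph V) (pi : V → ℝ) (x : V) (r : ℝ) (f : V → ℝ) : ℝ :=
  (vol G pi x r)⁻¹ * ∑ z ∈ gball G x r, f z * pi z

/-- Condition (PI(θ)): Poincaré inequality with constant `CP`. -/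
def CondPI (G : SimpleGraph V) (K : V → V → ℝ) (pi : V → ℝ) (θ CP : ℝ) : Prop :=
  ∀ x : V, ∀ r : ℝ, 0 < r → ∀ f : V → ℝ,
    (∑ z ∈ gball G x r, |f z - ballAvg G pi x r f| ^ 2 * pi z) ≤
      CP * r ^ θ * ∑ ξ ∈ gball G x r, ∑ ζ ∈ gball G x r,
        if G.Adj ξ ζ then |f ξ - f ζ| ^ 2 * K ξ ζ * pi ξ else 0

/-- Condition (CS(θ)): existence of cut-off functions. -/
def CondCS (G : SimpleGraph V) (K : V → V → ℝ) (pi : V → ℝ) (θ C1 C2 ε : ℝ) : Prop :=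
  ∀ x : V, ∀ r : ℝ, 0 < r → ∃ σ : V → ℝ,
    (∀ y ∈ gball G x (r / 2), 1 ≤ σ y) ∧
    (∀ y, y ∉ gball G x r → σ y = 0) ∧
    (∀ z y, |σ z - σ y| ≤ C1 * ((G.dist z y : ℝ) / r) ^ ε) ∧
    (∀ s : ℝ, 0 < s → s ≤ r → ∀ f : V → ℝ,
      (∑ z ∈ gball G x s, |f z| ^ 2 *
          ∑ y, (if G.Adj z y then |σ z - σ y| ^ 2 * K z y * pi z else 0)) ≤
        C2 * (s / r) ^ (2 * ε) *
          ((∑ z ∈ gball G x (2 * s), ∑ y ∈ gball G x (2 * s),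
              if G.Adj z y then |f z - f y| ^ 2 * K z y * pi z else 0) +
            s ^ (-θ) * ∑ z ∈ gball G x (2 * s), |f z| ^ 2 * pi z))

/-- The Harnack assumptions (E), (VD), (PI(θ)), (CS(θ)) with the given constants. -/
def Harnack (G : SimpleGraph V) (K : V → V → ℝ) (pi : V → ℝ)
    (θ p0 CD CP Ccs1 Ccs2 ε : ℝ) : Prop :=
  0 < p0 ∧ 0 < CD ∧ 0 < CP ∧ 0 < Ccs1 ∧ 0 < Ccs2 ∧ 0 < ε ∧
  CondE G K p0 ∧ CondVD G pi CD ∧ CondPI G K pi θ CP ∧ CondCS G K pi θ Ccs1 Ccs2 ε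

/-- The lamplighter kernel `K^⋄` on `{0,1}^V × V` associated with a kernel `K` on `V`. -/
noncomputable def lampK (K : V → V → ℝ) :
    ((V → Bool) × V) → ((V → Bool) × V) → ℝ := fun fv hw =>
  if fv.2 ≠ hw.2 ∧ ∀ u, u ≠ fv.2 → u ≠ hw.2 → fv.1 u = hw.1 u then K fv.2 hw.2 / 4
  else if fv.2 = hw.2 ∧ ∀ u, u ≠ fv.2 → fv.1 u = hw.1 u then K fv.2 fv.2 / 2
  else 0

/-- The relaxation time `(1 − λ₂)⁻¹` of a reversible kernel, via the variational
characterization of the spectral gap `1 − λ₂ = inf {𝓔(f,f) : π(f) = 0, ‖f‖²_π = 1}`. -/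
noncomputable def relaxTime {W : Type*} [Fintype W] (K : W → W → ℝ) (pi : W → ℝ) : ℝ :=
  (sInf { g : ℝ | ∃ f : W → ℝ, (∑ x, pi x * f x = 0) ∧ (∑ x, pi x * f x ^ 2 = 1) ∧
      g = ∑ x, pi x * f x * (f x - ∑ y, K x y * f y) })⁻¹

/-! ### Part 1: Fourier analysis on the lamps -/

/-- The sign of a lamp. -/
def lsgn (b : Bool) : ℝ := if b then -1 else 1

/-- The Walsh character attached to `A`. -/
noncomputable def chi (A : Finset V) (f : V → Bool) : ℝ := ∏ u ∈ A, lsgn (f u)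

lemma lsgn_mul (a b : Bool) : 1 + lsgn a * lsgn b = if a = b then 2 else 0 := by
  cases a <;> cases b <;> norm_num [lsgn]

lemma lsgn_sq (a : Bool) : lsgn a ^ 2 = 1 := by
  cases a <;> norm_num [lsgn]

lemma chi_orth (f g : V → Bool) :
    ∑ A : Finset V, chi A f * chi A g = if f = g then (2 : ℝ) ^ Fintype.card V else 0 := by
  have h : ∑ A : Finset V, chi A f * chi A g = ∏ u : V, (1 + lsgn (f u) * lsgn (g u)) := by
    rw [Finset.prod_one_add, Finset.powerset_univ]
    refine Finset.sum_congr rfl fun A _ => ?_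
    rw [chi, chi, Finset.prod_mul_distrib]
  rw [h]
  simp only [lsgn_mul]
  split_ifs with hfg
  · subst hfg
    simp [Finset.card_univ]
  · obtain ⟨u, hu⟩ := Function.ne_iff.mp hfg
    exact Finset.prod_eq_zero (Finset.mem_univ u) (by simp [hu])

lemma parseval (F G : (V → Bool) → ℝ) :
    ∑ A : Finset V, (∑ f, chi A f * F f) * (∑ f, chi A f * G f)
      = (2 : ℝ) ^ Fintype.card V * ∑ f, F f * G f := by
  calc ∑ A : Finset V, (∑ f, chi A f * F f) * (∑ f, chi A f * G f)
      = ∑ A : Finset V, ∑ f, ∑ g, (F f * G g) * (chi A f * chi A g) := by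
        refine Finset.sum_congr rfl fun A _ => ?_
        rw [Finset.sum_mul_sum]
        refine Finset.sum_congr rfl fun f _ => Finset.sum_congr rfl fun g _ => ?_
        ring
    _ = ∑ f, ∑ g, (F f * G g) * ∑ A : Finset V, (chi A f * chi A g) := by
        rw [Finset.sum_comm]
        refine Finset.sum_congr rfl fun f _ => ?_
        rw [Finset.sum_comm]
        refine Finset.sum_congr rfl fun g _ => ?_
        rw [Finset.mul_sum]
    _ = _ := by
        simp only [chi_orth, mul_ite, mul_zero]
        rw [Finset.mul_sum]
        refine Finset.sum_congr rfl fun f _ => ?_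
        rw [Finset.sum_ite_eq Finset.univ f]
        simp
        ring

lemma avg_adj (v : V) (H G : (V → Bool) → ℝ) :
    ∑ f, H f * ∑ a : Bool, G (Function.update f v a)
      = ∑ f, (∑ a : Bool, H (Function.update f v a)) * G f := by
  simp only [Finset.mul_sum, Finset.sum_mul]
  rw [← Fintype.sum_prod_type' (f := fun (f : V → Bool) (a : Bool) =>
      H f * G (Function.update f v a)),
    ← Fintype.sum_prod_type' (f := fun (f : V → Bool) (a : Bool) =>
      H (Function.update f v a) * G f)]
  refine Finset.sum_nbij' (fun p => (Function.update p.1 v p.2, p.1 v))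
    (fun p => (Function.update p.1 v p.2, p.1 v)) ?_ ?_ ?_ ?_ ?_ <;> simp

lemma chi_update (A : Finset V) (v : V) (f : V → Bool) :
    ∑ a : Bool, chi A (Function.update f v a) = (if v ∈ A then 0 else 2) * chi A f := by
  split_ifs with h
  · have : ∀ a, chi A (Function.update f v a) = lsgn a * chi (A.erase v) f := by
      intro a
      rw [chi, chi, ← Finset.mul_prod_erase A _ h, Function.update_self]
      congr 1
      refine Finset.prod_congr rfl fun u hu => ?_
      rw [Function.update_of_ne (Finset.ne_of_mem_erase hu)]
    simp [this, lsgn]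
  · have : ∀ a, chi A (Function.update f v a) = chi A f := by
      intro a
      refine Finset.prod_congr rfl fun u hu => ?_
      rw [Function.update_of_ne]
      rintro rfl
      exact h hu
    simp [this]

lemma lamp_apply (K : V → V → ℝ) (hK : ∀ v, K v v = 0) (F : (V → Bool) × V → ℝ)
    (f : V → Bool) (v : V) :
    ∑ hw, lampK K (f, v) hw * F hw =
      ∑ w, K v w / 4 * ∑ a : Bool, ∑ b : Bool,
        F (Function.update (Function.update f v a) w b, w) := by
  rw [Fintype.sum_prod_type_right]
  refine Finset.sum_congr rfl fun w _ => ?_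
  by_cases hvw : v = w
  · subst hvw
    simp [lampK, hK]
  · have h1 : ∀ h : V → Bool, lampK K (f, v) (h, w) * F (h, w) =
        if (∀ u, u ≠ v → u ≠ w → f u = h u) then K v w / 4 * F (h, w) else 0 := by
      intro h
      simp [lampK, hvw]
    simp only [h1]
    rw [← Finset.sum_filter, ← Finset.mul_sum]
    congr 1
    rw [← Fintype.sum_prod_type' (f := fun (a : Bool) (b : Bool) =>
      F (Function.update (Function.update f v a) w b, w))]
    refine Finset.sum_nbij' (fun h => (h v, h w))
      (fun p => Function.update (Function.update f v p.1) w p.2) ?_ ?_ ?_ ?_ ?_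
    · simp
    · rintro ⟨a, b⟩ _
      simp only [Finset.mem_filter, Finset.mem_univ, true_and]
      intro u h1 h2
      simp [h1, h2]
    · intro h hh
      simp only [Finset.mem_filter, Finset.mem_univ, true_and] at hh
      funext u
      by_cases h2 : u = w
      · subst h2; simp
      · by_cases h1 : u = v
        · subst h1; simp [h2]
        · simp [h1, h2, hh u h1 h2]
    · rintro ⟨a, b⟩ _
      simp [hvw]
    · intro h hh
      simp only [Finset.mem_filter, Finset.mem_univ, true_and] at hh
      congr 2
      funext u
      by_cases h2 : u = w
      · subst h2; simp
      · by_cases h1 : u = v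
        · subst h1; simp [h2]
        · simp [h1, h2, hh u h1 h2]

lemma lamp_coef (K : V → V → ℝ) (hK : ∀ v, K v v = 0) (F : (V → Bool) × V → ℝ)
    (A : Finset V) (v : V) :
    ∑ f, chi A f * ∑ hw, lampK K (f, v) hw * F hw =
      ∑ w, K v w * (if v ∈ A ∨ w ∈ A then 0 else ∑ f, chi A f * F (f, w)) := by
  simp only [lamp_apply K hK]
  have h0 : ∀ f : V → Bool, chi A f * ∑ w, K v w / 4 * ∑ a : Bool, ∑ b : Bool,
        F (Function.update (Function.update f v a) w b, w) =
      ∑ w, chi A f * (K v w / 4 * ∑ a : Bool, ∑ b : Bool,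
        F (Function.update (Function.update f v a) w b, w)) := fun f => by
    rw [Finset.mul_sum]
  simp only [h0]
  rw [Finset.sum_comm]
  refine Finset.sum_congr rfl fun w _ => ?_
  have h1 := avg_adj v (chi A) (fun f => ∑ b : Bool, F (Function.update f w b, w))
  have h2 := avg_adj w (chi A) (fun f => F (f, w))
  simp only [chi_update, mul_assoc, ← Finset.mul_sum] at h1 h2
  rw [h2] at h1
  calc ∑ f, chi A f * (K v w / 4 * ∑ a : Bool, ∑ b : Bool,
        F (Function.update (Function.update f v a) w b, w))
      = K v w / 4 * ∑ f, chi A f * ∑ a : Bool, ∑ b : Bool,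
        F (Function.update (Function.update f v a) w b, w) := by
        rw [Finset.mul_sum]
        refine Finset.sum_congr rfl fun f _ => by ring
    _ = _ := by
        rw [h1]
        by_cases hv : v ∈ A <;> by_cases hw : w ∈ A <;> simp [hv, hw]
        ring

/-- Poincaré inequality for the lamplighter walk. -/
lemma lamp_poincare (K : V → V → ℝ) (hK : ∀ v, K v v = 0) (T : ℝ) (hT : 1 ≤ T)
    (hDir : ∀ (x : V) (g : V → ℝ), g x = 0 →
      ∑ v, g v ^ 2 ≤ T * ∑ v, g v * (g v - ∑ w, K v w * g w))
    (hP : ∀ h : V → ℝ, ∑ v, h v = 0 →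
      ∑ v, h v ^ 2 ≤ T * ∑ v, h v * (h v - ∑ w, K v w * h w))
    (F : (V → Bool) × V → ℝ) (hF : ∑ p, F p = 0) :
    ∑ p, F p ^ 2 ≤ T * ∑ p, F p * (F p - ∑ q, lampK K p q * F q) := by
  set c : Finset V → V → ℝ := fun A v => ∑ f, chi A f * F (f, v) with hc
  set N2 : ℝ := (2 : ℝ) ^ Fintype.card V with hN2
  have hN2pos : 0 < N2 := by positivity
  have e1 : N2 * ∑ p, F p ^ 2 = ∑ A : Finset V, ∑ v, c A v ^ 2 := by
    rw [Fintype.sum_prod_type_right, Finset.mul_sum, Finset.sum_comm]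
    refine Finset.sum_congr rfl fun v _ => ?_
    have := parseval (fun f => F (f, v)) (fun f => F (f, v))
    simp only [pow_two]
    exact this.symm
  have e2 : N2 * ∑ p, F p * (F p - ∑ q, lampK K p q * F q) =
      ∑ A : Finset V, ∑ v, c A v *
        (c A v - ∑ w, K v w * (if v ∈ A ∨ w ∈ A then 0 else c A w)) := by
    rw [Fintype.sum_prod_type_right, Finset.mul_sum, Finset.sum_comm]
    refine Finset.sum_congr rfl fun v _ => ?_
    have := parseval (fun f => F (f, v))
      (fun f => F (f, v) - ∑ q, lampK K (f, v) q * F q)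
    rw [← this]
    refine Finset.sum_congr rfl fun A _ => ?_
    congr 1
    simp only [mul_sub, Finset.sum_sub_distrib]
    rw [lamp_coef K hK]
  have key : ∀ A : Finset V, ∑ v, c A v ^ 2 ≤ T * ∑ v, c A v *
        (c A v - ∑ w, K v w * (if v ∈ A ∨ w ∈ A then 0 else c A w)) := by
    intro A
    rcases A.eq_empty_or_nonempty with rfl | ⟨x, hx⟩
    · simp only [Finset.notMem_empty, or_self, if_false]
      apply hP
      simp only [hc, chi, Finset.prod_empty, one_mul]
      rw [← hF, Fintype.sum_prod_type_right]
    · set g : V → ℝ := fun v => if v ∈ A then 0 else c A v with hg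
      have h1 := hDir x g (by simp [hg, hx])
      have h2 : ∑ v, c A v ^ 2 = ∑ v, g v ^ 2 + ∑ v, (if v ∈ A then c A v ^ 2 else 0) := by
        rw [← Finset.sum_add_distrib]
        refine Finset.sum_congr rfl fun v _ => ?_
        by_cases hv : v ∈ A <;> simp [hg, hv]
      have h3 : ∑ v, c A v * (c A v - ∑ w, K v w * (if v ∈ A ∨ w ∈ A then 0 else c A w)) =
          ∑ v, g v * (g v - ∑ w, K v w * g w) + ∑ v, (if v ∈ A then c A v ^ 2 else 0) := by
        rw [← Finset.sum_add_distrib]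
        refine Finset.sum_congr rfl fun v _ => ?_
        by_cases hv : v ∈ A
        · simp [hg, hv, pow_two]
        · simp [hg, hv]
      have h4 : 0 ≤ ∑ v, (if v ∈ A then c A v ^ 2 else 0) :=
        Finset.sum_nonneg fun v _ => by split_ifs <;> positivity
      rw [h2, h3]
      nlinarith
  have h5 : N2 * ∑ p, F p ^ 2 ≤ N2 * (T * ∑ p, F p * (F p - ∑ q, lampK K p q * F q)) := by
    rw [mul_left_comm, e1, e2, Finset.mul_sum]
    exact Finset.sum_le_sum fun A _ => key A
  exact le_of_mul_le_mul_left h5 hN2pos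

lemma chi_single_sum (x : V) : ∑ f : V → Bool, chi {x} f = 0 := by
  have := avg_adj x (chi {x}) (fun _ => (1 : ℝ))
  simp only [chi_update] at this
  simp at this
  rw [← Finset.sum_mul] at this
  linarith

/-- The lifted test function. -/
lemma lamp_test (K : V → V → ℝ) (hK : ∀ v, K v v = 0) (x : V) (g : V → ℝ) (hg : g x = 0) :
    ∃ F : (V → Bool) × V → ℝ, ∑ p, F p = 0 ∧
      ∑ p, F p ^ 2 = (2 : ℝ) ^ Fintype.card V * ∑ v, g v ^ 2 ∧
      ∑ p, F p * (F p - ∑ q, lampK K p q * F q) =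
        (2 : ℝ) ^ Fintype.card V * ∑ v, g v * (g v - ∑ w, K v w * g w) := by
  have hsq : ∀ f : V → Bool, chi {x} f * chi {x} f = 1 := by
    intro f
    simp [chi, ← pow_two, lsgn_sq]
  have hcard : (∑ _f : V → Bool, (1 : ℝ)) = (2 : ℝ) ^ Fintype.card V := by
    simp
  refine ⟨fun p => chi {x} p.1 * g p.2, ?_, ?_, ?_⟩
  · rw [Fintype.sum_prod_type_right]
    simp [← Finset.sum_mul, chi_single_sum]
  · rw [Fintype.sum_prod_type_right, Finset.mul_sum]
    refine Finset.sum_congr rfl fun v _ => ?_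
    rw [← hcard, Finset.sum_mul]
    refine Finset.sum_congr rfl fun f _ => ?_
    simp only
    rw [mul_pow, pow_two (chi _ _), hsq]
  · rw [Fintype.sum_prod_type_right, Finset.mul_sum]
    refine Finset.sum_congr rfl fun v _ => ?_
    by_cases hv : v = x
    · subst hv; simp [hg]
    rw [← hcard, Finset.sum_mul]
    refine Finset.sum_congr rfl fun f _ => ?_
    have h1 : ∑ q, lampK K (f, v) q * (chi {x} q.1 * g q.2) =
        chi {x} f * ∑ w, K v w * g w := by
      rw [lamp_apply K hK, Finset.mul_sum]
      refine Finset.sum_congr rfl fun w _ => ?_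
      by_cases hw : w = x
      · subst hw; simp [hg]
      · simp [chi, Function.update_of_ne (Ne.symm hw), Function.update_of_ne (Ne.symm hv)]
        ring
    simp only [h1]
    linear_combination (g v * (g v - ∑ w, K v w * g w)) * hsq f

lemma relax_bounds {W : Type*} [Fintype W] (Q : W → W → ℝ) (c T t : ℝ) (hc : 0 < c)
    (hT : 0 < T)
    (hP : ∀ F : W → ℝ, ∑ p, F p = 0 → ∑ p, F p ^ 2 ≤ T * ∑ p, F p * (F p - ∑ q, Q p q * F q))
    (hL : ∃ F : W → ℝ, ∑ p, F p = 0 ∧ 0 < ∑ p, F p ^ 2 ∧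
      t * ∑ p, F p * (F p - ∑ q, Q p q * F q) ≤ ∑ p, F p ^ 2) :
    t ≤ relaxTime Q (fun _ => c) ∧ relaxTime Q (fun _ => c) ≤ T := by
  set S := { g : ℝ | ∃ f : W → ℝ, (∑ x, c * f x = 0) ∧ (∑ x, c * f x ^ 2 = 1) ∧
      g = ∑ x, c * f x * (f x - ∑ y, Q x y * f y) } with hS
  have hlow : ∀ g ∈ S, T⁻¹ ≤ g := by
    rintro g ⟨f, h1, h2, rfl⟩
    rw [← Finset.mul_sum] at h1 h2
    simp only [mul_assoc, ← Finset.mul_sum]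
    have h3 := hP f (by
      rcases mul_eq_zero.mp h1 with h | h
      · exact absurd h hc.ne'
      · exact h)
    rw [inv_le_iff_one_le_mul₀ hT, ← h2]
    calc c * ∑ x, f x ^ 2 ≤ c * (T * ∑ p, f p * (f p - ∑ q, Q p q * f q)) := by gcongr
      _ = _ := by ring
  obtain ⟨F, hF1, hF2, hF3⟩ := hL
  set M := ∑ p, F p ^ 2 with hM
  set E := ∑ p, F p * (F p - ∑ q, Q p q * F q) with hE
  have hcM : 0 < c * M := by positivity
  have hmem : E / M ∈ S := by
    refine ⟨fun p => (Real.sqrt (c * M))⁻¹ * F p, ?_, ?_, ?_⟩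
    · simp only [← Finset.mul_sum, hF1, mul_zero]
    · simp only [mul_pow, ← Finset.mul_sum, ← hM, inv_pow, Real.sq_sqrt hcM.le]
      field_simp
    · have : ∀ x, c * ((Real.sqrt (c * M))⁻¹ * F x) * ((Real.sqrt (c * M))⁻¹ * F x -
          ∑ y, Q x y * ((Real.sqrt (c * M))⁻¹ * F y)) =
          (c * (c * M)⁻¹) * (F x * (F x - ∑ q, Q x q * F q)) := by
        intro x
        have h1 : ∀ ρ : ℝ, ∑ y, Q x y * (ρ * F y) = ρ * ∑ q, Q x q * F q := by
          intro ρ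
          rw [Finset.mul_sum]
          refine Finset.sum_congr rfl fun y _ => by ring
        rw [h1]
        have h2 : (c * M)⁻¹ = (Real.sqrt (c * M))⁻¹ * (Real.sqrt (c * M))⁻¹ := by
          rw [← mul_inv, Real.mul_self_sqrt hcM.le]
        rw [h2]; ring
      simp only [this, ← Finset.mul_sum, ← hE]
      field_simp
  have hlb : T⁻¹ ≤ sInf S := le_csInf ⟨_, hmem⟩ hlow
  have hpos : 0 < sInf S := lt_of_lt_of_le (inv_pos.mpr hT) hlb
  have hub : sInf S ≤ E / M := csInf_le ⟨T⁻¹, hlow⟩ hmem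
  have hr : relaxTime Q (fun _ => c) = (sInf S)⁻¹ := rfl
  rw [hr]
  constructor
  · rw [← one_div, le_div_iff₀ hpos]
    rcases le_or_gt t 0 with ht | ht
    · nlinarith
    · calc t * sInf S ≤ t * (E / M) := by gcongr
        _ = t * E / M := by ring
        _ ≤ 1 := by rw [div_le_one hF2]; exact hF3
  · rw [inv_le_comm₀ hpos hT]; exact hlb

/-! ### Part 2: graphs -/

/-- The properties of the graph and the kernel which are used in the estimates. -/
structure NiceG (G : SimpleGraph V) (K : V → V → ℝ) : Prop where
  conn : G.Connected
  sym : ∀ x y, K x y = K y x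
  nonneg : ∀ x y, 0 ≤ K x y
  row : ∀ x, ∑ y, K x y = 1
  off : ∀ x y, ¬ G.Adj x y → K x y = 0
  ball : ∀ x y r, (gball G x r).card = (gball G y r).card
  far : ∀ x, ∃ y, G.dist x y = gdiam G

/-- The (doubled, unnormalized) energy. -/
noncomputable def en (K : V → V → ℝ) (g : V → ℝ) : ℝ := ∑ v, ∑ w, K v w * (g v - g w) ^ 2

/-- Dyadic radii. -/
noncomputable def rk (k : ℕ) : ℝ := 2 ^ k / 2

/-- The dyadic scale terms. -/
noncomputable def aa (G : SimpleGraph V) (θ : ℝ) (x : V) (k : ℕ) : ℝ :=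
  rk k ^ θ * (Fintype.card V : ℝ) / ((gball G x (rk k)).card : ℝ)

/-- The dyadic sum. -/
noncomputable def AA (G : SimpleGraph V) (θ : ℝ) (x : V) : ℝ :=
  ∑ k ∈ Finset.range (Nat.log 2 (gdiam G) + 1), aa G θ x k

lemma rk_pos (k : ℕ) : 0 < rk k := by unfold rk; positivity

lemma rk_succ (k : ℕ) : rk (k + 1) = 2 * rk k := by unfold rk; ring

lemma rk_two (k : ℕ) : 2 * rk k = 2 ^ k := by unfold rk; ring

lemma rk_mono {j k : ℕ} (h : j ≤ k) : rk j ≤ rk k := by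
  unfold rk
  have : (2 : ℝ) ^ j ≤ 2 ^ k := pow_le_pow_right₀ (by norm_num) h
  linarith

lemma mem_gball (G : SimpleGraph V) (x y : V) (r : ℝ) :
    y ∈ gball G x r ↔ (G.dist x y : ℝ) ≤ r := by simp [gball]

lemma gball_pos (G : SimpleGraph V) (x : V) (r : ℝ) (hr : 0 ≤ r) :
    (0 : ℝ) < (gball G x r).card := by
  exact_mod_cast Finset.card_pos.mpr ⟨x, by simp [mem_gball, hr]⟩

lemma gball_le (G : SimpleGraph V) (x : V) (r : ℝ) :
    ((gball G x r).card : ℝ) ≤ Fintype.card V := by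
  exact_mod_cast Finset.card_le_univ _

lemma gball_mono (G : SimpleGraph V) (x : V) {r s : ℝ} (h : r ≤ s) :
    ((gball G x r).card : ℝ) ≤ (gball G x s).card := by
  have : gball G x r ⊆ gball G x s := fun y hy => by
    rw [mem_gball] at *; linarith
  exact_mod_cast Finset.card_le_card this

lemma dist_le_gdiam (G : SimpleGraph V) (x y : V) : G.dist x y ≤ gdiam G := by
  unfold gdiam
  exact (Finset.le_sup (f := fun y => G.dist x y) (Finset.mem_univ y)).trans
    (Finset.le_sup (f := fun x => Finset.univ.sup fun y => G.dist x y) (Finset.mem_univ x))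

lemma gball_univ (G : SimpleGraph V) (x : V) : gball G x (gdiam G) = Finset.univ := by
  ext y
  simp [mem_gball, dist_le_gdiam]

lemma gball_zero (G : SimpleGraph V) (hG : G.Connected) (x : V) (r : ℝ) (h0 : 0 ≤ r)
    (hr : r < 1) : gball G x r = {x} := by
  ext y
  rw [mem_gball, Finset.mem_singleton]
  constructor
  · intro h
    have h1 : (G.dist x y : ℝ) < 1 := lt_of_le_of_lt h hr
    have h2 : G.dist x y = 0 := by
      have : G.dist x y < 1 := by exact_mod_cast h1
      omega
    exact (hG.dist_eq_zero_iff.mp h2).symm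
  · rintro rfl
    simpa using h0

lemma aa_nonneg (G : SimpleGraph V) (θ : ℝ) (x : V) (k : ℕ) : 0 ≤ aa G θ x k := by
  unfold aa
  have := (rk_pos k).le
  positivity

lemma rk_le_aa (G : SimpleGraph V) (θ : ℝ) (x : V) (k : ℕ) : rk k ^ θ ≤ aa G θ x k := by
  unfold aa
  rw [le_div_iff₀ (gball_pos G x _ (rk_pos k).le)]
  have := Real.rpow_nonneg (rk_pos k).le θ
  exact mul_le_mul_of_nonneg_left (gball_le G x _) this

lemma aa_le_AA (G : SimpleGraph V) (θ : ℝ) (x : V) (k : ℕ) (hk : k ≤ Nat.log 2 (gdiam G)) :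
    aa G θ x k ≤ AA G θ x := by
  unfold AA
  exact Finset.single_le_sum (f := fun k => aa G θ x k) (fun i _ => aa_nonneg G θ x i)
    (Finset.mem_range.mpr (by omega))

lemma aa_zero (G : SimpleGraph V) (hG : G.Connected) (θ : ℝ) (x : V) :
    (Fintype.card V : ℝ) = 2 ^ θ * aa G θ x 0 := by
  have h1 : rk 0 = (2 : ℝ)⁻¹ := by norm_num [rk]
  unfold aa
  rw [gball_zero G hG x (rk 0) (rk_pos 0).le (by rw [h1]; norm_num), h1,
    Real.inv_rpow (by norm_num)]
  have : (0 : ℝ) < 2 ^ θ := by positivity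
  simp
  field_simp

lemma diam_lt (G : SimpleGraph V) : (gdiam G : ℝ) ≤ 4 * rk (Nat.log 2 (gdiam G)) := by
  have h : gdiam G < 2 ^ (Nat.log 2 (gdiam G) + 1) := Nat.lt_pow_succ_log_self (by norm_num) _
  have h2 : (gdiam G : ℝ) < 2 ^ (Nat.log 2 (gdiam G) + 1) := by exact_mod_cast h
  rw [pow_succ, ← rk_two] at h2
  linarith

lemma diam_pow_le (G : SimpleGraph V) (θ : ℝ) (hθ : 0 ≤ θ) :
    (gdiam G : ℝ) ^ θ ≤ 4 ^ θ * rk (Nat.log 2 (gdiam G)) ^ θ := by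
  rw [← Real.mul_rpow (by norm_num) (rk_pos _).le]
  exact Real.rpow_le_rpow (by positivity) (diam_lt G) hθ

lemma en_eq (K : V → V → ℝ) (hs : ∀ x y, K x y = K y x) (hr : ∀ x, ∑ y, K x y = 1)
    (g : V → ℝ) : ∑ v, g v * (g v - ∑ w, K v w * g w) = en K g / 2 := by
  have h1 : ∑ v, ∑ w, K v w * g v ^ 2 = ∑ v, g v ^ 2 := by
    refine Finset.sum_congr rfl fun v _ => ?_
    rw [← Finset.sum_mul, hr, one_mul]
  have h2 : ∑ v, ∑ w, K v w * g w ^ 2 = ∑ v, g v ^ 2 := by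
    rw [Finset.sum_comm, ← h1]
    refine Finset.sum_congr rfl fun v _ => Finset.sum_congr rfl fun w _ => ?_
    rw [hs]
  have h3 : en K g = ∑ v, ∑ w, K v w * g v ^ 2 + ∑ v, ∑ w, K v w * g w ^ 2
      - 2 * ∑ v, ∑ w, K v w * (g v * g w) := by
    unfold en
    rw [Finset.mul_sum, ← Finset.sum_add_distrib, ← Finset.sum_sub_distrib]
    refine Finset.sum_congr rfl fun v _ => ?_
    rw [Finset.mul_sum, ← Finset.sum_add_distrib, ← Finset.sum_sub_distrib]
    refine Finset.sum_congr rfl fun w _ => ?_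
    ring
  rw [h3, h1, h2]
  have h4 : ∑ v, g v * (g v - ∑ w, K v w * g w) =
      ∑ v, g v ^ 2 - ∑ v, ∑ w, K v w * (g v * g w) := by
    rw [← Finset.sum_sub_distrib]
    refine Finset.sum_congr rfl fun v _ => ?_
    rw [mul_sub, Finset.mul_sum, pow_two]
    congr 1
    refine Finset.sum_congr rfl fun w _ => ?_
    ring
  rw [h4]
  ring

lemma poin (G : SimpleGraph V) (K : V → V → ℝ) (hoff : ∀ x y, ¬ G.Adj x y → K x y = 0)
    (θ CP : ℝ) (h : CondPI G K (fun _ => (Fintype.card V : ℝ)⁻¹) θ CP) (x : V) (r : ℝ)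
    (hr : 0 < r) (f : V → ℝ) :
    ∃ m : ℝ, ∑ z ∈ gball G x r, (f z - m) ^ 2 ≤
      CP * r ^ θ * ∑ ξ ∈ gball G x r, ∑ ζ ∈ gball G x r, K ξ ζ * (f ξ - f ζ) ^ 2 := by
  have hN : (0 : ℝ) < Fintype.card V := by
    exact_mod_cast Fintype.card_pos_iff.mpr ⟨x⟩
  refine ⟨ballAvg G (fun _ => (Fintype.card V : ℝ)⁻¹) x r f, ?_⟩
  have h1 := h x r hr f
  have h2 : ∀ ξ ζ, (if G.Adj ξ ζ then (f ξ - f ζ) ^ 2 * K ξ ζ * (Fintype.card V : ℝ)⁻¹ else 0)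
      = K ξ ζ * (f ξ - f ζ) ^ 2 * (Fintype.card V : ℝ)⁻¹ := by
    intro ξ ζ
    split_ifs with hh
    · ring
    · rw [hoff _ _ hh]; ring
  simp only [h2, sq_abs, ← Finset.sum_mul] at h1
  rw [← mul_assoc] at h1
  exact le_of_mul_le_mul_right h1 (inv_pos.mpr hN)

/-- Average over a finite set. -/
noncomputable def avg (B : Finset V) (f : V → ℝ) : ℝ := (∑ z ∈ B, f z) / B.card

lemma avg_sub (B B' : Finset V) (hB : B' ⊆ B) (f : V → ℝ) (m E : ℝ)
    (hE : ∑ z ∈ B, (f z - m) ^ 2 ≤ E) (hne : 0 < (B'.card : ℝ)) :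
    (avg B' f - m) ^ 2 ≤ E / B'.card := by
  have h1 : ∑ z ∈ B', (f z - m) = B'.card * (avg B' f - m) := by
    rw [Finset.sum_sub_distrib, avg]
    simp
    field_simp
  have h2 := sq_sum_le_card_mul_sum_sq (s := B') (f := fun z => f z - m)
  rw [h1] at h2
  have h3 : ∑ z ∈ B', (f z - m) ^ 2 ≤ E :=
    (Finset.sum_le_sum_of_subset_of_nonneg hB fun _ _ _ => sq_nonneg _).trans hE
  rw [le_div_iff₀ hne]
  have h4 : (B'.card : ℝ) * ((avg B' f - m) ^ 2 * B'.card) ≤ B'.card * E := by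
    calc _ = (B'.card * (avg B' f - m)) ^ 2 := by ring
      _ ≤ _ := h2
      _ ≤ _ := by gcongr
  exact le_of_mul_le_mul_left h4 hne

lemma exists_geod (G : SimpleGraph V) (hG : G.Connected) (x y : V) :
    ∃ γ : ℕ → V, (∀ i ≤ G.dist x y, G.dist x (γ i) = i) ∧
      ∀ i j, i ≤ j → j ≤ G.dist x y → G.dist (γ i) (γ j) ≤ j - i := by
  obtain ⟨p, hp⟩ := hG.exists_walk_length_eq_dist x y
  have hstep : ∀ i j, i ≤ j → j ≤ G.dist x y → G.dist (p.getVert i) (p.getVert j) ≤ j - i := by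
    intro i j hij
    induction j, hij using Nat.le_induction with
    | base => simp
    | succ j hij ih =>
      intro hj
      have h1 := ih (by omega)
      have h2 : G.dist (p.getVert j) (p.getVert (j + 1)) = 1 :=
        SimpleGraph.dist_eq_one_iff_adj.mpr (p.adj_getVert_succ (by omega))
      have h3 := hG.dist_triangle (u := p.getVert i) (v := p.getVert j) (w := p.getVert (j + 1))
      omega
  refine ⟨p.getVert, ?_, hstep⟩
  intro i hi
  have h1 := hstep 0 i (by omega) hi
  have h2 := hstep i (G.dist x y) hi le_rfl
  rw [SimpleGraph.Walk.getVert_zero] at h1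
  rw [← hp, SimpleGraph.Walk.getVert_length, hp] at h2
  have h3 := hG.dist_triangle (u := x) (v := p.getVert i) (w := y)
  omega

lemma count3 (n M : ℕ) :
    ((Finset.range M).filter fun k => 2 ^ k ≤ n ∧ n < 8 * 2 ^ k).card ≤ 3 := by
  have hsub : ((Finset.range M).filter fun k => 2 ^ k ≤ n ∧ n < 8 * 2 ^ k) ⊆
      Finset.Icc (Nat.log 2 n - 2) (Nat.log 2 n) := by
    intro k hk
    simp only [Finset.mem_filter] at hk
    obtain ⟨_, h1, h2⟩ := hk
    rw [Finset.mem_Icc]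
    have hn : n ≠ 0 := by
      have : 0 < 2 ^ k := by positivity
      omega
    have h3 : k ≤ Nat.log 2 n := Nat.le_log_of_pow_le (by norm_num) h1
    have h4 : Nat.log 2 n < k + 3 := by
      apply Nat.log_lt_of_lt_pow hn
      rw [pow_add]
      omega
    omega
  refine (Finset.card_le_card hsub).trans ?_
  rw [Nat.card_Icc]
  omega

/-! ### Part 3: the upper bound -/

lemma en_nonneg (K : V → V → ℝ) (hn : ∀ x y, 0 ≤ K x y) (f : V → ℝ) : 0 ≤ en K f :=
  Finset.sum_nonneg fun v _ => Finset.sum_nonneg fun w _ => mul_nonneg (hn v w) (sq_nonneg _)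

lemma edge_le_en (K : V → V → ℝ) (hn : ∀ x y, 0 ≤ K x y) (f : V → ℝ) (x z : V) :
    K x z * (f x - f z) ^ 2 ≤ en K f := by
  have h1 : K x z * (f x - f z) ^ 2 ≤ ∑ w, K x w * (f x - f w) ^ 2 :=
    Finset.single_le_sum (f := fun w => K x w * (f x - f w) ^ 2)
      (fun w _ => mul_nonneg (hn x w) (sq_nonneg _)) (Finset.mem_univ z)
  have h2 : ∑ w, K x w * (f x - f w) ^ 2 ≤ en K f :=
    Finset.single_le_sum (f := fun v => ∑ w, K v w * (f v - f w) ^ 2)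
      (fun v _ => Finset.sum_nonneg fun w _ => mul_nonneg (hn v w) (sq_nonneg _))
      (Finset.mem_univ x)
  exact h1.trans h2

/-- Energies in the Whitney balls add up to at most three times the total energy. -/
lemma whitney_energy (G : SimpleGraph V) (K : V → V → ℝ) (hG : NiceG G K) (x : V)
    (z : ℕ → V) (M : ℕ) (hz : ∀ k < M, (G.dist x (z (k + 1)) : ℝ) = 2 ^ (k + 1)) (f : V → ℝ) :
    ∑ k ∈ Finset.range M, (∑ ξ ∈ gball G (z (k + 1)) (3 * rk k),
      ∑ ζ ∈ gball G (z (k + 1)) (3 * rk k), K ξ ζ * (f ξ - f ζ) ^ 2) ≤ 3 * en K f := by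
  have h1 : ∀ k ∈ Finset.range M, (∑ ξ ∈ gball G (z (k + 1)) (3 * rk k),
      ∑ ζ ∈ gball G (z (k + 1)) (3 * rk k), K ξ ζ * (f ξ - f ζ) ^ 2) ≤
      ∑ ξ, (if (2 ^ k ≤ 2 * G.dist x ξ ∧ 2 * G.dist x ξ < 8 * 2 ^ k) then (1 : ℝ) else 0) *
        ∑ ζ, K ξ ζ * (f ξ - f ζ) ^ 2 := by
    intro k hk
    have hk := Finset.mem_range.mp hk
    calc _ ≤ ∑ ξ ∈ gball G (z (k + 1)) (3 * rk k),
          (if (2 ^ k ≤ 2 * G.dist x ξ ∧ 2 * G.dist x ξ < 8 * 2 ^ k) then (1 : ℝ) else 0) *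
            ∑ ζ, K ξ ζ * (f ξ - f ζ) ^ 2 := by
          refine Finset.sum_le_sum fun ξ hξ => ?_
          rw [mem_gball] at hξ
          have t1 : (G.dist x ξ : ℝ) ≤ G.dist x (z (k + 1)) + G.dist (z (k + 1)) ξ := by
            exact_mod_cast hG.conn.dist_triangle
          have t2 : (G.dist x (z (k + 1)) : ℝ) ≤ G.dist x ξ + G.dist (z (k + 1)) ξ := by
            rw [G.dist_comm (u := z (k + 1)) (v := ξ)]
            exact_mod_cast hG.conn.dist_triangle
          rw [hz k hk, pow_succ, ← rk_two] at t1 t2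
          have e := rk_two k
          have hpos := rk_pos k
          have c1 : 2 ^ k ≤ 2 * G.dist x ξ := by
            have : (2 : ℝ) ^ k ≤ 2 * G.dist x ξ := by linarith
            exact_mod_cast this
          have c2 : 2 * G.dist x ξ < 8 * 2 ^ k := by
            have : (2 : ℝ) * G.dist x ξ < 8 * 2 ^ k := by linarith
            exact_mod_cast this
          rw [if_pos ⟨c1, c2⟩, one_mul]
          exact Finset.sum_le_sum_of_subset_of_nonneg (Finset.subset_univ _)
            fun w _ _ => mul_nonneg (hG.nonneg _ _) (sq_nonneg _)
      _ ≤ _ := by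
          refine Finset.sum_le_sum_of_subset_of_nonneg (Finset.subset_univ _) fun w _ _ => ?_
          refine mul_nonneg (by split_ifs <;> norm_num) ?_
          exact Finset.sum_nonneg fun u _ => mul_nonneg (hG.nonneg _ _) (sq_nonneg _)
  refine (Finset.sum_le_sum h1).trans ?_
  rw [Finset.sum_comm]
  unfold en
  rw [Finset.mul_sum]
  refine Finset.sum_le_sum fun ξ _ => ?_
  rw [← Finset.sum_mul]
  refine mul_le_mul_of_nonneg_right ?_
    (Finset.sum_nonneg fun u _ => mul_nonneg (hG.nonneg _ _) (sq_nonneg _))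
  rw [Finset.sum_boole]
  exact_mod_cast count3 (2 * G.dist x ξ) M

lemma upper_dir (G : SimpleGraph V) (K : V → V → ℝ) (hG : NiceG G K) (θ p0 CP : ℝ)
    (hθ : 2 ≤ θ) (hp0 : 0 < p0) (hCP : 0 < CP) (hE : CondE G K p0)
    (hPI : CondPI G K (fun _ => (Fintype.card V : ℝ)⁻¹) θ CP) (hD : 1 ≤ gdiam G)
    (x : V) (f : V → ℝ) (hf : f x = 0) :
    ∑ v, f v ^ 2 ≤ (2 * CP * 4 ^ θ + 6 * (2 ^ θ / p0 + 12 * CP * 3 ^ θ + CP * 4 ^ θ)) *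
      AA G θ x * en K f := by
  set N : ℝ := (Fintype.card V : ℝ) with hN
  have hNpos : 0 < N := by
    rw [hN]; exact_mod_cast Fintype.card_pos_iff.mpr ⟨x⟩
  set L := Nat.log 2 (gdiam G) with hL
  set A := AA G θ x with hA
  have hEn := en_nonneg K hG.nonneg f
  have hDpos : (0 : ℝ) < gdiam G := by exact_mod_cast hD
  -- the geodesic
  obtain ⟨y, hy⟩ := hG.far x
  obtain ⟨γ, hγ1, hγ2⟩ := exists_geod G hG.conn x y
  rw [hy] at hγ1 hγ2
  have hpow : ∀ k ≤ L, 2 ^ k ≤ gdiam G := fun k hk =>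
    (Nat.pow_le_pow_right (by norm_num) hk).trans (Nat.pow_log_le_self 2 (by omega))
  set z : ℕ → V := fun k => γ (2 ^ k) with hz
  have hz1 : ∀ k ≤ L, (G.dist x (z k) : ℝ) = 2 ^ k := fun k hk => by
    rw [hz]; simp only; rw [hγ1 _ (hpow k hk)]; push_cast; rfl
  -- global Poincaré
  obtain ⟨m, hm⟩ := poin G K hG.off θ CP hPI x (gdiam G) hDpos f
  rw [gball_univ] at hm
  change ∑ z, (f z - m) ^ 2 ≤ CP * (gdiam G : ℝ) ^ θ * en K f at hm
  have hDθ : (gdiam G : ℝ) ^ θ ≤ 4 ^ θ * A :=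
    (diam_pow_le G θ (by linarith)).trans
      (mul_le_mul_of_nonneg_left ((rk_le_aa G θ x L).trans (aa_le_AA G θ x L le_rfl))
        (by positivity))
  -- the averages
  set av : ℕ → ℝ := fun k => avg (gball G (z k) (rk k)) f with hav
  have hbz : ∀ k r, ((gball G (z k) r).card : ℝ) = (gball G x r).card := fun k r => by
    exact_mod_cast hG.ball _ _ _
  have hav0 : av 0 = f (z 0) := by
    rw [hav]; simp only
    rw [gball_zero G hG.conn (z 0) (rk 0) (rk_pos 0).le (by norm_num [rk])]
    simp [avg]
  have s1 : N * (f (z 0) - f x) ^ 2 ≤ 2 ^ θ / p0 * A * en K f := by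
    have hadj : G.Adj x (z 0) := by
      rw [← SimpleGraph.dist_eq_one_iff_adj]
      have := hz1 0 (by omega)
      rw [pow_zero] at this
      exact_mod_cast this
    have h1 := edge_le_en K hG.nonneg f x (z 0)
    have h2 := hE x (z 0) hadj
    have h3 : p0 * (f (z 0) - f x) ^ 2 ≤ en K f := by
      refine le_trans ?_ h1
      rw [sub_sq_comm]
      exact mul_le_mul_of_nonneg_right h2 (sq_nonneg _)
    have h4 : N ≤ 2 ^ θ * A := by
      rw [hN, aa_zero G hG.conn θ x]
      exact mul_le_mul_of_nonneg_left (aa_le_AA G θ x 0 (by omega)) (by positivity)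
    calc N * (f (z 0) - f x) ^ 2 = N / p0 * (p0 * (f (z 0) - f x) ^ 2) := by field_simp
      _ ≤ N / p0 * en K f := by gcongr
      _ ≤ (2 ^ θ * A) / p0 * en K f := by gcongr
      _ = _ := by ring
  have s3 : N * (av L - m) ^ 2 ≤ CP * 4 ^ θ * A * en K f := by
    have h1 := avg_sub Finset.univ (gball G (z L) (rk L)) (Finset.subset_univ _) f m _ hm
      (gball_pos G _ _ (rk_pos L).le)
    rw [hbz] at h1
    have hb := gball_pos G x _ (rk_pos L).le
    calc N * (av L - m) ^ 2 ≤ N * (CP * (gdiam G : ℝ) ^ θ * en K f /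
          (gball G x (rk L)).card) := by
          exact mul_le_mul_of_nonneg_left h1 hNpos.le
      _ = CP * ((gdiam G : ℝ) ^ θ) * (N / (gball G x (rk L)).card) * en K f := by ring
      _ ≤ CP * (4 ^ θ * rk L ^ θ) * (N / (gball G x (rk L)).card) * en K f := by
          gcongr
          exact diam_pow_le G θ (by linarith)
      _ = CP * 4 ^ θ * aa G θ x L * en K f := by unfold aa; ring
      _ ≤ _ := by
          gcongr
          exact aa_le_AA G θ x L le_rfl
  have s2 : N * (av L - av 0) ^ 2 ≤ 12 * CP * 3 ^ θ * A * en K f := by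
    set Q : ℕ → ℝ := fun k => ∑ ξ ∈ gball G (z (k + 1)) (3 * rk k),
      ∑ ζ ∈ gball G (z (k + 1)) (3 * rk k), K ξ ζ * (f ξ - f ζ) ^ 2 with hQ
    have hQn : ∀ k, 0 ≤ Q k := fun k => Finset.sum_nonneg fun v _ =>
      Finset.sum_nonneg fun w _ => mul_nonneg (hG.nonneg v w) (sq_nonneg _)
    have hQs : ∑ k ∈ Finset.range L, Q k ≤ 3 * en K f :=
      whitney_energy G K hG x z L (fun k hk => hz1 (k + 1) (by omega)) f
    have hstep : ∀ k ∈ Finset.range L, (av (k + 1) - av k) ^ 2 ≤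
        (4 * CP * 3 ^ θ / N * aa G θ x k) * Q k := by
      intro k hk
      have hk := Finset.mem_range.mp hk
      have hr := rk_pos k
      have hb := gball_pos G x _ (rk_pos k).le
      have hb' := gball_pos G x _ (rk_pos (k + 1)).le
      obtain ⟨m', hm'⟩ := poin G K hG.off θ CP hPI (z (k + 1)) (3 * rk k) (by linarith) f
      have i1 := avg_sub _ (gball G (z k) (rk k)) (by
        intro u hu
        rw [mem_gball] at *
        have h1 := hγ2 (2 ^ k) (2 ^ (k + 1)) (Nat.pow_le_pow_right (by norm_num) (by omega))
          (hpow _ (by omega))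
        have h2 : G.dist (z (k + 1)) (z k) ≤ 2 ^ k := by
          rw [G.dist_comm]
          refine h1.trans ?_
          rw [pow_succ]; omega
        have h3 : (G.dist (z (k + 1)) (z k) : ℝ) ≤ 2 ^ k := by exact_mod_cast h2
        have h4 : (G.dist (z (k + 1)) u : ℝ) ≤ G.dist (z (k + 1)) (z k) + G.dist (z k) u := by
          exact_mod_cast hG.conn.dist_triangle
        have := rk_two k
        linarith) f m' _ hm' (gball_pos G _ _ (rk_pos _).le)
      have i2 := avg_sub _ (gball G (z (k + 1)) (rk (k + 1))) (by
        intro u hu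
        rw [mem_gball] at *
        rw [rk_succ] at hu
        linarith) f m' _ hm' (gball_pos G _ _ (rk_pos _).le)
      rw [hbz] at i1 i2
      change (av k - m') ^ 2 ≤ CP * (3 * rk k) ^ θ * Q k / _ at i1
      change (av (k + 1) - m') ^ 2 ≤ CP * (3 * rk k) ^ θ * Q k / _ at i2
      have hnn : 0 ≤ CP * (3 * rk k) ^ θ * Q k := by
        have := hQn k
        positivity
      have i3 : (av (k + 1) - m') ^ 2 ≤ CP * (3 * rk k) ^ θ * Q k / (gball G x (rk k)).card := by
        refine i2.trans ?_
        exact div_le_div_of_nonneg_left hnn hb (gball_mono G x (rk_mono (by omega)))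
      have i4 : (av (k + 1) - av k) ^ 2 ≤
          4 * (CP * (3 * rk k) ^ θ * Q k / (gball G x (rk k)).card) := by
        nlinarith [sq_nonneg ((av (k + 1) - m') + (av k - m'))]
      refine i4.trans (le_of_eq ?_)
      rw [Real.mul_rpow (by norm_num) hr.le]
      unfold aa
      rw [← hN]
      field_simp
    have hcs := Finset.sum_sq_le_sum_mul_sum_of_sq_le_mul (Finset.range L)
      (r := fun k => av (k + 1) - av k) (f := fun k => 4 * CP * 3 ^ θ / N * aa G θ x k) (g := Q)
      (fun k _ => by have := aa_nonneg G θ x k; positivity) (fun k _ => hQn k) hstep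
    rw [Finset.sum_range_sub, ← Finset.mul_sum] at hcs
    have hsumA : ∑ k ∈ Finset.range L, aa G θ x k ≤ A := by
      rw [hA, AA, Finset.sum_range_succ]
      have := aa_nonneg G θ x L
      linarith
    have hA0 : 0 ≤ A := Finset.sum_nonneg fun k _ => aa_nonneg G θ x k
    calc N * (av L - av 0) ^ 2 ≤ N * ((4 * CP * 3 ^ θ / N *
          ∑ k ∈ Finset.range L, aa G θ x k) * ∑ k ∈ Finset.range L, Q k) := by gcongr
      _ ≤ N * ((4 * CP * 3 ^ θ / N * A) * (3 * en K f)) := by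
          have := Finset.sum_nonneg fun k (_ : k ∈ Finset.range L) => hQn k
          gcongr
      _ = _ := by field_simp; ring
  have hm2 : N * m ^ 2 ≤ 3 * (2 ^ θ / p0 + 12 * CP * 3 ^ θ + CP * 4 ^ θ) * A * en K f := by
    have h1 : m ^ 2 ≤ 3 * ((f (z 0) - f x) ^ 2 + (av L - av 0) ^ 2 + (av L - m) ^ 2) := by
      have e : m = (f (z 0) - f x) + (av L - av 0) - (av L - m) := by
        rw [hav0, hf]; ring
      set a := f (z 0) - f x
      set b := av L - av 0
      set c := av L - m
      rw [e]
      nlinarith [sq_nonneg (a - b), sq_nonneg (a + c), sq_nonneg (b + c)]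
    have h2 := mul_le_mul_of_nonneg_left h1 hNpos.le
    linarith
  have hfin : ∑ v, f v ^ 2 ≤ 2 * ∑ v, (f v - m) ^ 2 + 2 * (N * m ^ 2) := by
    have : N * m ^ 2 = ∑ _v : V, m ^ 2 := by simp [hN]
    rw [this, Finset.mul_sum, Finset.mul_sum, ← Finset.sum_add_distrib]
    refine Finset.sum_le_sum fun v _ => ?_
    nlinarith [sq_nonneg (f v - 2 * m)]
  have hm3 : CP * (gdiam G : ℝ) ^ θ * en K f ≤ CP * (4 ^ θ * A) * en K f := by gcongr
  linarith

/-! ### Part 4: the lower bound -/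

lemma vol_eq (G : SimpleGraph V) (x : V) (r : ℝ) :
    vol G (fun _ => (Fintype.card V : ℝ)⁻¹) x r =
      (gball G x r).card * (Fintype.card V : ℝ)⁻¹ := by
  simp [vol]

lemma vd_card (G : SimpleGraph V) (CD : ℝ)
    (h : CondVD G (fun _ => (Fintype.card V : ℝ)⁻¹) CD) (x : V) (r : ℝ) (hr : 0 < r) :
    ((gball G x (2 * r)).card : ℝ) ≤ CD * (gball G x r).card := by
  have hN : (0 : ℝ) < Fintype.card V := by
    exact_mod_cast Fintype.card_pos_iff.mpr ⟨x⟩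
  have h1 := h x r hr
  rw [vol_eq, vol_eq, ← mul_assoc] at h1
  exact le_of_mul_le_mul_right h1 (inv_pos.mpr hN)

lemma cutoff (G : SimpleGraph V) (K : V → V → ℝ) (hG : NiceG G K) (θ CD C1 C2 ε : ℝ)
    (hC2 : 0 < C2)
    (hVD : CondVD G (fun _ => (Fintype.card V : ℝ)⁻¹) CD)
    (hCS : CondCS G K (fun _ => (Fintype.card V : ℝ)⁻¹) θ C1 C2 ε) (x : V) (k : ℕ) :
    ∃ τ : V → ℝ, (∀ y ∈ gball G x (rk k / 2), τ y = 1) ∧ (∀ y ∉ gball G x (rk k), τ y = 0) ∧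
      aa G θ x k * en K τ ≤ 2 * C2 * CD * Fintype.card V := by
  have hN : (0 : ℝ) < Fintype.card V := by
    exact_mod_cast Fintype.card_pos_iff.mpr ⟨x⟩
  have hr := rk_pos k
  have hb := gball_pos G x (rk k) hr.le
  obtain ⟨σ, h1, h2, -, h4⟩ := hCS x (rk k) hr
  set τ : V → ℝ := fun y => max 0 (min 1 (σ y)) with hτ
  have hτ0 : ∀ y ∉ gball G x (rk k), τ y = 0 := fun y hy => by simp [hτ, h2 y hy]
  refine ⟨τ, fun y hy => by simp [hτ, h1 y hy], hτ0, ?_⟩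
  have h5 := h4 (rk k) hr le_rfl (fun _ => 1)
  have hif : ∀ z y, (if G.Adj z y then (σ z - σ y) ^ 2 * K z y * (Fintype.card V : ℝ)⁻¹ else 0)
      = K z y * (σ z - σ y) ^ 2 * (Fintype.card V : ℝ)⁻¹ := by
    intro ξ ζ
    split_ifs with hh
    · ring
    · rw [hG.off _ _ hh]; ring
  simp only [sq_abs, hif, ← Finset.sum_mul, div_self hr.ne', Real.one_rpow] at h5
  simp only [one_pow, one_mul, sub_self, ne_eq, OfNat.ofNat_ne_zero, not_false_eq_true, zero_pow,
    zero_mul, ite_self, Finset.sum_const_zero, zero_add, mul_one, Finset.sum_const,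
    nsmul_eq_mul, ← Finset.sum_mul] at h5
  have h6 : ∑ z ∈ gball G x (rk k), ∑ y, K z y * (σ z - σ y) ^ 2 ≤
      C2 * (rk k ^ (-θ) * (gball G x (2 * rk k)).card) := by
    refine le_of_mul_le_mul_right ?_ (inv_pos.mpr hN)
    calc _ ≤ _ := h5
      _ = _ := by ring
  have hlip : ∀ z y, (τ z - τ y) ^ 2 ≤ (σ z - σ y) ^ 2 := by
    intro z y
    rw [sq_le_sq]
    calc |τ z - τ y| ≤ |min 1 (σ z) - min 1 (σ y)| := by
          have := abs_max_sub_max_le_abs (min 1 (σ z)) (min 1 (σ y)) 0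
          simpa [hτ, max_comm] using this
      _ ≤ |σ z - σ y| := by
          have := abs_min_sub_min_le_max 1 (σ z) 1 (σ y)
          simpa using this
  have h7 : ∑ z ∈ gball G x (rk k), ∑ y, K z y * (τ z - τ y) ^ 2 ≤
      C2 * (rk k ^ (-θ) * (gball G x (2 * rk k)).card) :=
    le_trans (Finset.sum_le_sum fun z _ => Finset.sum_le_sum fun y _ =>
      mul_le_mul_of_nonneg_left (hlip z y) (hG.nonneg z y)) h6
  have h8 : en K τ ≤ 2 * ∑ z ∈ gball G x (rk k), ∑ y, K z y * (τ z - τ y) ^ 2 := by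
    have e1 : ∑ z ∈ gball G x (rk k), ∑ y, K z y * (τ z - τ y) ^ 2 =
        ∑ z, ∑ y, (if z ∈ gball G x (rk k) then K z y * (τ z - τ y) ^ 2 else 0) := by
      rw [← Finset.sum_subset (Finset.subset_univ (gball G x (rk k)))]
      · refine Finset.sum_congr rfl fun z hz => Finset.sum_congr rfl fun y _ => ?_
        rw [if_pos hz]
      · intro z _ hz
        simp [hz]
    have e2 : ∑ z ∈ gball G x (rk k), ∑ y, K z y * (τ z - τ y) ^ 2 =
        ∑ z, ∑ y, (if y ∈ gball G x (rk k) then K z y * (τ z - τ y) ^ 2 else 0) := by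
      rw [e1, Finset.sum_comm]
      refine Finset.sum_congr rfl fun z _ => Finset.sum_congr rfl fun y _ => ?_
      rw [hG.sym z y, sub_sq_comm]
    rw [two_mul]
    nth_rewrite 1 [e1]
    rw [e2]
    unfold en
    rw [← Finset.sum_add_distrib]
    refine Finset.sum_le_sum fun z _ => ?_
    rw [← Finset.sum_add_distrib]
    refine Finset.sum_le_sum fun y _ => ?_
    have hnn : 0 ≤ K z y * (τ z - τ y) ^ 2 := mul_nonneg (hG.nonneg _ _) (sq_nonneg _)
    by_cases hz : z ∈ gball G x (rk k)
    · by_cases hy : y ∈ gball G x (rk k) <;> simp [hz, hy, hnn]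
    · by_cases hy : y ∈ gball G x (rk k)
      · simp [hz, hy]
      · simp [hz, hy, hτ0]
  have hvd := vd_card G CD hVD x (rk k) hr
  have hrθ : (0 : ℝ) < rk k ^ θ := by positivity
  calc aa G θ x k * en K τ
      ≤ aa G θ x k * (2 * (C2 * (rk k ^ (-θ) * (CD * (gball G x (rk k)).card)))) := by
        refine mul_le_mul_of_nonneg_left ?_ (aa_nonneg G θ x k)
        refine h8.trans ?_
        refine mul_le_mul_of_nonneg_left (h7.trans ?_) (by norm_num)
        gcongr
    _ = 2 * C2 * CD * Fintype.card V := by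
        unfold aa
        rw [Real.rpow_neg hr.le]
        field_simp

lemma lower_test (G : SimpleGraph V) (K : V → V → ℝ) (hG : NiceG G K) (θ CD C1 C2 ε : ℝ)
    (hCD : 0 < CD) (hC2 : 0 < C2)
    (hVD : CondVD G (fun _ => (Fintype.card V : ℝ)⁻¹) CD)
    (hCS : CondCS G K (fun _ => (Fintype.card V : ℝ)⁻¹) θ C1 C2 ε) (hD : 1 ≤ gdiam G) (x : V) :
    ∃ g : V → ℝ, g x = 0 ∧ 0 < ∑ v, g v ^ 2 ∧
      AA G θ x * (en K g / 2) ≤ 3 * C2 * CD ^ 3 * ∑ v, g v ^ 2 := by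
  set N : ℝ := (Fintype.card V : ℝ) with hN
  have hNpos : 0 < N := by
    rw [hN]; exact_mod_cast Fintype.card_pos_iff.mpr ⟨x⟩
  set L := Nat.log 2 (gdiam G) with hL
  set A := AA G θ x with hA
  have hApos : 0 < A := by
    have h1 := rk_le_aa G θ x 0
    have h2 := aa_le_AA G θ x 0 (by omega)
    have h3 : 0 < rk 0 ^ θ := Real.rpow_pos_of_pos (rk_pos 0) θ
    linarith
  choose τ hτ1 hτ0 hτe using cutoff G K hG θ CD C1 C2 ε hC2 hVD hCS x
  set F : V → ℝ := fun v => ∑ k ∈ Finset.range (L + 1), aa G θ x k * τ k v with hF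
  have hFx : F x = A := by
    rw [hA, AA, hF]
    refine Finset.sum_congr rfl fun k _ => ?_
    rw [hτ1 k x (by rw [mem_gball]; have := rk_pos k; simp; linarith), mul_one]
  have hFfar : ∀ v, v ∉ gball G x (rk L) → F v = 0 := by
    intro v hv
    refine Finset.sum_eq_zero fun k hk => ?_
    rw [hτ0 k v, mul_zero]
    rw [mem_gball] at *
    have := rk_mono (Nat.lt_succ_iff.mp (Finset.mem_range.mp hk))
    intro h
    linarith
  -- energy of F
  have hloc : ∀ v w, G.Adj v w → (F v - F w) ^ 2 ≤
      3 * ∑ k ∈ Finset.range (L + 1), (aa G θ x k * (τ k v - τ k w)) ^ 2 := by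
    intro v w hvw
    set m := min (G.dist x v) (G.dist x w) with hm
    have hd1 : G.dist v w = 1 := SimpleGraph.dist_eq_one_iff_adj.mpr hvw
    have hd2 : G.dist w v = 1 := SimpleGraph.dist_eq_one_iff_adj.mpr hvw.symm
    have t1 := hG.conn.dist_triangle (u := x) (v := v) (w := w)
    have t2 := hG.conn.dist_triangle (u := x) (v := w) (w := v)
    rw [hd1] at t1
    rw [hd2] at t2
    have hzero : ∀ k, ¬ (2 ^ k ≤ 4 * m + 3 ∧ 4 * m + 3 < 8 * 2 ^ k) → τ k v - τ k w = 0 := by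
      intro k hk
      have hin : ∀ u, 4 * G.dist x u ≤ 2 ^ k → τ k u = 1 := by
        intro u hu
        apply hτ1
        rw [mem_gball]
        have : (4 : ℝ) * G.dist x u ≤ 2 ^ k := by exact_mod_cast hu
        rw [← rk_two] at this
        linarith
      have hout : ∀ u, 2 ^ k < 2 * G.dist x u → τ k u = 0 := by
        intro u hu
        apply hτ0
        rw [mem_gball]
        have : (2 : ℝ) ^ k < 2 * G.dist x u := by exact_mod_cast hu
        rw [← rk_two] at this
        intro h
        linarith
      have hp : 1 ≤ 2 ^ k := Nat.one_le_two_pow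
      by_cases c1 : 4 * G.dist x v ≤ 2 ^ k ∧ 4 * G.dist x w ≤ 2 ^ k
      · rw [hin v c1.1, hin w c1.2, sub_self]
      · by_cases c2 : 2 ^ k < 2 * G.dist x v ∧ 2 ^ k < 2 * G.dist x w
        · rw [hout v c2.1, hout w c2.2, sub_self]
        · exfalso
          apply hk
          generalize 2 ^ k = p at *
          omega
    have e1 : F v - F w = ∑ k ∈ Finset.range (L + 1), aa G θ x k * (τ k v - τ k w) := by
      rw [hF]
      simp only
      rw [← Finset.sum_sub_distrib]
      refine Finset.sum_congr rfl fun k _ => by ring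
    have e2 : F v - F w = ∑ k ∈ (Finset.range (L + 1)).filter
        (fun k => 2 ^ k ≤ 4 * m + 3 ∧ 4 * m + 3 < 8 * 2 ^ k), aa G θ x k * (τ k v - τ k w) := by
      rw [e1, Finset.sum_filter]
      refine Finset.sum_congr rfl fun k _ => ?_
      split_ifs with h
      · rfl
      · rw [hzero k h, mul_zero]
    rw [e2]
    refine sq_sum_le_card_mul_sum_sq.trans ?_
    have hc := count3 (4 * m + 3) (L + 1)
    have hc' : ((((Finset.range (L + 1)).filter
        (fun k => 2 ^ k ≤ 4 * m + 3 ∧ 4 * m + 3 < 8 * 2 ^ k)).card : ℕ) : ℝ) ≤ 3 := by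
      exact_mod_cast hc
    refine mul_le_mul hc' ?_ (Finset.sum_nonneg fun k _ => sq_nonneg _) (by norm_num)
    exact Finset.sum_le_sum_of_subset_of_nonneg (Finset.filter_subset _ _)
      fun _ _ _ => sq_nonneg _
  have hen : en K F ≤ 3 * (2 * C2 * CD * N) * A := by
    have h1 : en K F ≤ ∑ v, ∑ w, K v w *
        (3 * ∑ k ∈ Finset.range (L + 1), (aa G θ x k * (τ k v - τ k w)) ^ 2) := by
      refine Finset.sum_le_sum fun v _ => Finset.sum_le_sum fun w _ => ?_
      by_cases h : G.Adj v w
      · exact mul_le_mul_of_nonneg_left (hloc v w h) (hG.nonneg v w)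
      · rw [hG.off v w h]; simp
    have h2 : ∑ v, ∑ w, K v w *
        (3 * ∑ k ∈ Finset.range (L + 1), (aa G θ x k * (τ k v - τ k w)) ^ 2) =
        3 * ∑ k ∈ Finset.range (L + 1), aa G θ x k ^ 2 * en K (τ k) := by
      have q1 : ∀ v w, K v w *
          (3 * ∑ k ∈ Finset.range (L + 1), (aa G θ x k * (τ k v - τ k w)) ^ 2) =
          ∑ k ∈ Finset.range (L + 1), 3 * (aa G θ x k ^ 2 * (K v w * (τ k v - τ k w) ^ 2)) := by
        intro v w
        rw [Finset.mul_sum, Finset.mul_sum]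
        refine Finset.sum_congr rfl fun k _ => by ring
      have q2 : ∀ v, ∑ w, ∑ k ∈ Finset.range (L + 1),
          3 * (aa G θ x k ^ 2 * (K v w * (τ k v - τ k w) ^ 2)) =
          ∑ k ∈ Finset.range (L + 1), ∑ w, 3 * (aa G θ x k ^ 2 *
            (K v w * (τ k v - τ k w) ^ 2)) := fun v => Finset.sum_comm
      simp only [q1, q2]
      rw [Finset.sum_comm]
      simp only [← Finset.mul_sum]
      rfl
    rw [h2] at h1
    refine h1.trans ?_
    have h3 : ∑ k ∈ Finset.range (L + 1), aa G θ x k ^ 2 * en K (τ k) ≤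
        ∑ k ∈ Finset.range (L + 1), (2 * C2 * CD * N) * aa G θ x k := by
      refine Finset.sum_le_sum fun k _ => ?_
      calc aa G θ x k ^ 2 * en K (τ k) = (aa G θ x k * en K (τ k)) * aa G θ x k := by ring
        _ ≤ _ := mul_le_mul_of_nonneg_right (hτe k) (aa_nonneg G θ x k)
    rw [← Finset.mul_sum] at h3
    change _ ≤ 2 * C2 * CD * N * A at h3
    linarith
  -- the test function
  have hmass : N / CD ^ 2 * A ^ 2 ≤ ∑ v, (A - F v) ^ 2 := by
    obtain ⟨y, hy⟩ := hG.far x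
    have hDpos : (0 : ℝ) < gdiam G := by exact_mod_cast hD
    have v1 := vd_card G CD hVD y ((gdiam G : ℝ) / 4) (by linarith)
    have v2 := vd_card G CD hVD y ((gdiam G : ℝ) / 2) (by linarith)
    rw [show (2 : ℝ) * (gdiam G / 4) = gdiam G / 2 by ring] at v1
    rw [show (2 : ℝ) * (gdiam G / 2) = gdiam G by ring, gball_univ, Finset.card_univ] at v2
    have v3 : N / CD ^ 2 ≤ (gball G y ((gdiam G : ℝ) / 4)).card := by
      rw [div_le_iff₀ (by positivity)]
      have := mul_le_mul_of_nonneg_left v1 hCD.le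
      calc N ≤ _ := v2
        _ ≤ _ := this
        _ = _ := by ring
    have hsub : ∀ v ∈ gball G y ((gdiam G : ℝ) / 4), F v = 0 := by
      intro v hv
      apply hFfar
      rw [mem_gball] at *
      have t : (G.dist x y : ℝ) ≤ G.dist x v + G.dist y v := by
        rw [G.dist_comm (u := y) (v := v)]
        exact_mod_cast hG.conn.dist_triangle
      rw [hy] at t
      have hp : (2 : ℝ) ^ L ≤ gdiam G := by
        exact_mod_cast Nat.pow_log_le_self 2 (by omega)
      rw [← rk_two] at hp
      intro h
      linarith
    calc N / CD ^ 2 * A ^ 2 ≤ (gball G y ((gdiam G : ℝ) / 4)).card * A ^ 2 := by gcongr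
      _ = ∑ v ∈ gball G y ((gdiam G : ℝ) / 4), (A - F v) ^ 2 := by
          rw [Finset.sum_congr rfl (fun v hv => by rw [hsub v hv])]
          simp
      _ ≤ _ := Finset.sum_le_sum_of_subset_of_nonneg (Finset.subset_univ _)
            fun _ _ _ => sq_nonneg _
  refine ⟨fun v => A - F v, by simp [hFx], ?_, ?_⟩
  · refine lt_of_lt_of_le ?_ hmass
    positivity
  · have e : en K (fun v => A - F v) = en K F := by
      unfold en
      refine Finset.sum_congr rfl fun v _ => Finset.sum_congr rfl fun w _ => by ring
    rw [e]
    calc A * (en K F / 2) ≤ A * (3 * (2 * C2 * CD * N) * A / 2) := by gcongr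
      _ = 3 * C2 * CD ^ 3 * (N / CD ^ 2 * A ^ 2) := by field_simp
      _ ≤ _ := by gcongr

/-! ### Part 5: comparison of the two sums and conclusion -/

/-- The sum appearing in the theorem, in terms of cardinalities. -/
noncomputable def SS (G : SimpleGraph V) (θ : ℝ) (x : V) : ℝ :=
  ∑ n ∈ Finset.Iic ⌊2 * (gdiam G : ℝ) ^ θ⌋₊,
    (Fintype.card V : ℝ) / (gball G x ((n : ℝ) ^ (1 / θ))).card

lemma S_le_A (G : SimpleGraph V) (hG : G.Connected) (θ : ℝ) (hθ : 2 ≤ θ) (x : V) :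
    SS G θ x ≤ (2 * 4 ^ θ + 2 ^ θ) * AA G θ x := by
  have hθ0 : 0 ≤ θ := by linarith
  set L := Nat.log 2 (gdiam G) with hL
  set N : ℝ := (Fintype.card V : ℝ) with hN
  have hN0 : 0 ≤ N := by positivity
  set c : ℝ := 2 * 4 ^ θ with hc
  have hc2 : (2 : ℝ) ^ θ ≤ c := by
    have h1 : (2 : ℝ) ^ θ ≤ 4 ^ θ := Real.rpow_le_rpow (by norm_num) (by norm_num) hθ0
    have h2 : (0 : ℝ) < 4 ^ θ := by positivity
    linarith
  have key : ∀ n ∈ Finset.Iic ⌊2 * (gdiam G : ℝ) ^ θ⌋₊, ∃ k ∈ Finset.range (L + 1),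
      (n : ℝ) ≤ c * rk k ^ θ ∧
        ((gball G x (rk k)).card : ℝ) ≤ (gball G x ((n : ℝ) ^ (1 / θ))).card := by
    intro n hn
    rw [Finset.mem_Iic] at hn
    have hn2 : (n : ℝ) ≤ 2 * (gdiam G : ℝ) ^ θ := by
      rwa [Nat.le_floor_iff (by positivity)] at hn
    set ρ : ℝ := (n : ℝ) ^ (1 / θ) with hρ
    have hρ0 : 0 ≤ ρ := by positivity
    have hρn : ρ ^ θ = n := by
      rw [hρ, ← Real.rpow_mul (by positivity), one_div_mul_cancel (by linarith), Real.rpow_one]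
    rcases Nat.eq_zero_or_pos n with h0 | hpos
    · refine ⟨0, by simp, ?_, ?_⟩
      · rw [h0]
        have := (rk_pos 0).le
        simp only [Nat.cast_zero]
        positivity
      · rw [gball_zero G hG x (rk 0) (rk_pos 0).le (by norm_num [rk])]
        have := gball_pos G x ρ hρ0
        have : 0 < (gball G x ρ).card := by exact_mod_cast this
        rw [Finset.card_singleton]
        exact_mod_cast this
    · have hρ1 : 1 ≤ ρ := Real.one_le_rpow (by exact_mod_cast hpos) (by positivity)
      set j := Nat.log 2 ⌊ρ⌋₊ with hj
      have hfl : ⌊ρ⌋₊ ≠ 0 := by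
        have : 1 ≤ ⌊ρ⌋₊ := Nat.le_floor (by simpa using hρ1)
        omega
      have hj1 : (2 : ℝ) ^ j ≤ ρ := by
        have h1 : 2 ^ j ≤ ⌊ρ⌋₊ := Nat.pow_log_le_self 2 hfl
        have h2 : ((2 ^ j : ℕ) : ℝ) ≤ ρ := (Nat.le_floor_iff hρ0).mp h1
        exact_mod_cast h2
      have hj2 : ρ < 2 ^ (j + 1) := by
        have h1 : ⌊ρ⌋₊ < 2 ^ (j + 1) := Nat.lt_pow_succ_log_self (by norm_num) _
        have h2 := (Nat.floor_lt hρ0).mp h1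
        exact_mod_cast h2
      by_cases hjL : j + 1 ≤ L
      · refine ⟨j + 1, by simp; omega, ?_, ?_⟩
        · rw [← hρn]
          calc ρ ^ θ ≤ (2 * rk (j + 1)) ^ θ := by
                rw [rk_two]
                exact Real.rpow_le_rpow hρ0 hj2.le hθ0
            _ = 2 ^ θ * rk (j + 1) ^ θ := Real.mul_rpow (by norm_num) (rk_pos _).le
            _ ≤ c * rk (j + 1) ^ θ := by
                have := Real.rpow_nonneg (rk_pos (j + 1)).le θ
                gcongr
        · apply gball_mono
          rw [rk_succ, rk_two]
          exact hj1
      · refine ⟨L, by simp, ?_, ?_⟩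
        · have := diam_pow_le G θ hθ0
          rw [hc]
          linarith
        · apply gball_mono
          have h1 : rk L ≤ rk (j + 1) := rk_mono (by omega)
          rw [rk_succ, rk_two] at h1
          linarith
  have step1 : ∀ n ∈ Finset.Iic ⌊2 * (gdiam G : ℝ) ^ θ⌋₊,
      N / (gball G x ((n : ℝ) ^ (1 / θ))).card ≤
      ∑ k ∈ Finset.range (L + 1),
        (if (n : ℝ) ≤ c * rk k ^ θ then (1 : ℝ) else 0) * (N / (gball G x (rk k)).card) := by
    intro n hn
    obtain ⟨k, hk, h1, h2⟩ := key n hn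
    have h3 : N / (gball G x ((n : ℝ) ^ (1 / θ))).card ≤
        (if (n : ℝ) ≤ c * rk k ^ θ then (1 : ℝ) else 0) * (N / (gball G x (rk k)).card) := by
      rw [if_pos h1, one_mul]
      exact div_le_div_of_nonneg_left hN0 (gball_pos G x _ (rk_pos k).le) h2
    refine h3.trans (Finset.single_le_sum (f := fun k =>
        (if (n : ℝ) ≤ c * rk k ^ θ then (1 : ℝ) else 0) * (N / (gball G x (rk k)).card))
        (fun i _ => ?_) hk)
    refine mul_nonneg (by split_ifs <;> norm_num) (by positivity)
  unfold SS
  refine (Finset.sum_le_sum step1).trans ?_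
  rw [Finset.sum_comm, AA, Finset.mul_sum]
  refine Finset.sum_le_sum fun k _ => ?_
  rw [← Finset.sum_mul, Finset.sum_boole]
  have hrk := rk_pos k
  have hrθ : 0 < rk k ^ θ := by positivity
  have hc0 : 0 < c := by positivity
  have hcard : ((((Finset.Iic ⌊2 * (gdiam G : ℝ) ^ θ⌋₊).filter
      (fun n : ℕ => (n : ℝ) ≤ c * rk k ^ θ)).card : ℕ) : ℝ) ≤ c * rk k ^ θ + 1 := by
    have hsub : (Finset.Iic ⌊2 * (gdiam G : ℝ) ^ θ⌋₊).filter
      (fun n : ℕ => (n : ℝ) ≤ c * rk k ^ θ) ⊆ Finset.Iic ⌊c * rk k ^ θ⌋₊ := by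
      intro n hn
      rw [Finset.mem_filter] at hn
      rw [Finset.mem_Iic]
      exact Nat.le_floor hn.2
    have h1 := Finset.card_le_card hsub
    rw [Nat.card_Iic] at h1
    have h2 : (⌊c * rk k ^ θ⌋₊ : ℝ) ≤ c * rk k ^ θ := Nat.floor_le (by positivity)
    have h3 : ((((Finset.Iic ⌊2 * (gdiam G : ℝ) ^ θ⌋₊).filter
      (fun n : ℕ => (n : ℝ) ≤ c * rk k ^ θ)).card : ℕ) : ℝ) ≤ (⌊c * rk k ^ θ⌋₊ : ℝ) + 1 := by
      exact_mod_cast h1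
    linarith
  have hone : 1 ≤ 2 ^ θ * rk k ^ θ := by
    rw [← Real.mul_rpow (by norm_num) hrk.le, rk_two]
    exact Real.one_le_rpow (one_le_pow₀ (by norm_num)) hθ0
  calc _ ≤ (c * rk k ^ θ + 1) * (N / (gball G x (rk k)).card) := by gcongr
    _ ≤ (c * rk k ^ θ + 2 ^ θ * rk k ^ θ) * (N / (gball G x (rk k)).card) := by gcongr
    _ = _ := by unfold aa; ring

lemma A_le_S (G : SimpleGraph V) (hG : G.Connected) (θ : ℝ) (hθ : 2 ≤ θ) (hD : 1 ≤ gdiam G)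
    (x : V) : AA G θ x ≤ 4 * SS G θ x := by
  have hθ0 : 0 ≤ θ := by linarith
  set N : ℝ := (Fintype.card V : ℝ) with hN
  have hN0 : 0 ≤ N := by positivity
  set ν : ℕ → ℝ := fun n => N / (gball G x ((n : ℝ) ^ (1 / θ))).card with hν
  have hν0 : ∀ n, 0 ≤ ν n := fun n => by positivity
  have h22 : (4 : ℝ) ≤ 2 ^ θ := by
    calc (4 : ℝ) = 2 ^ (2 : ℝ) := by norm_num
      _ ≤ 2 ^ θ := Real.rpow_le_rpow_of_exponent_le (by norm_num) hθ
  have ind : ∀ K : ℕ, ∑ k ∈ Finset.range (K + 1), aa G θ x k ≤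
      4 * ∑ n ∈ Finset.range (⌊rk K ^ θ⌋₊ + 1), ν n := by
    intro K
    induction K with
    | zero =>
      have hr0 : rk 0 ^ θ < 1 := Real.rpow_lt_one (rk_pos 0).le (by norm_num [rk]) (by linarith)
      rw [Nat.floor_eq_zero.mpr hr0]
      have e := aa_zero G hG θ x
      have h1 : ν 0 = N := by
        rw [hν]
        simp only [Nat.cast_zero]
        rw [Real.zero_rpow (by positivity), gball_zero G hG x 0 le_rfl one_pos]
        simp
      simp only [zero_add, Finset.sum_range_one, h1]
      have := aa_nonneg G θ x 0
      rw [hN, e]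
      nlinarith
    | succ K ih =>
      rw [Finset.sum_range_succ]
      have hb : rk (K + 1) ^ θ = 2 ^ θ * rk K ^ θ := by
        rw [rk_succ, Real.mul_rpow (by norm_num) (rk_pos K).le]
      have ha0 : 0 < rk K ^ θ := Real.rpow_pos_of_pos (rk_pos K) θ
      set a := rk K ^ θ with ha
      set b := rk (K + 1) ^ θ with hbdef
      have hab : 4 * a ≤ b := by rw [hb]; gcongr
      have hb1 : 1 ≤ b := by
        refine Real.one_le_rpow ?_ hθ0
        rw [rk_succ, rk_two]
        exact one_le_pow₀ (by norm_num)
      have hfl : ⌊a⌋₊ ≤ ⌊b⌋₊ := Nat.floor_le_floor (by linarith)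
      have hcount : b ≤ 4 * ((⌊b⌋₊ : ℝ) - ⌊a⌋₊) := by
        have f1 : b < ⌊b⌋₊ + 1 := Nat.lt_floor_add_one b
        have f2 : (⌊a⌋₊ : ℝ) ≤ a := Nat.floor_le ha0.le
        have f3 : (1 : ℝ) ≤ ⌊b⌋₊ := by
          have : 1 ≤ ⌊b⌋₊ := Nat.le_floor (by simpa using hb1)
          exact_mod_cast this
        by_cases hlt : a < 1
        · rw [Nat.floor_eq_zero.mpr hlt]
          push_cast
          linarith
        · linarith
      rw [← Finset.sum_range_add_sum_Ico ν (show ⌊a⌋₊ + 1 ≤ ⌊b⌋₊ + 1 by omega)]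
      have hlast : aa G θ x (K + 1) ≤ 4 * ∑ n ∈ Finset.Ico (⌊a⌋₊ + 1) (⌊b⌋₊ + 1), ν n := by
        set w := N / (gball G x (rk (K + 1))).card with hw
        have hw0 : 0 ≤ w := by positivity
        have hterm : ∀ n ∈ Finset.Ico (⌊a⌋₊ + 1) (⌊b⌋₊ + 1), w ≤ ν n := by
          intro n hn
          rw [Finset.mem_Ico] at hn
          have h1 : (n : ℝ) ≤ b := (Nat.le_floor_iff (by linarith)).mp (by omega)
          have h2 : (n : ℝ) ^ (1 / θ) ≤ rk (K + 1) := by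
            calc (n : ℝ) ^ (1 / θ) ≤ b ^ (1 / θ) :=
                  Real.rpow_le_rpow (by positivity) h1 (by positivity)
              _ = rk (K + 1) := by
                  rw [hbdef, ← Real.rpow_mul (rk_pos _).le, mul_one_div_cancel (by linarith),
                    Real.rpow_one]
          exact div_le_div_of_nonneg_left hN0 (gball_pos G x _ (by positivity))
            (gball_mono G x h2)
        have hsum := Finset.card_nsmul_le_sum _ _ _ hterm
        rw [Nat.card_Ico, nsmul_eq_mul] at hsum
        have hcast : (((⌊b⌋₊ + 1 - (⌊a⌋₊ + 1) : ℕ)) : ℝ) = (⌊b⌋₊ : ℝ) - ⌊a⌋₊ := by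
          rw [Nat.add_sub_add_right, Nat.cast_sub hfl]
        rw [hcast] at hsum
        have e : aa G θ x (K + 1) = b * w := by
          unfold aa; rw [hw, hbdef, hN]; ring
        rw [e]
        nlinarith
      linarith
  refine (ind (Nat.log 2 (gdiam G))).trans ?_
  refine mul_le_mul_of_nonneg_left ?_ (by norm_num)
  unfold SS
  refine Finset.sum_le_sum_of_subset_of_nonneg ?_ fun n _ _ => hν0 n
  intro n hn
  rw [Finset.mem_range] at hn
  rw [Finset.mem_Iic]
  refine (Nat.lt_succ_iff.mp hn).trans (Nat.floor_le_floor ?_)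
  have hp : (2 : ℝ) ^ (Nat.log 2 (gdiam G)) ≤ gdiam G := by
    exact_mod_cast Nat.pow_log_le_self 2 (by omega)
  rw [← rk_two] at hp
  have hr := rk_pos (Nat.log 2 (gdiam G))
  have h1 : rk (Nat.log 2 (gdiam G)) ^ θ ≤ (gdiam G : ℝ) ^ θ :=
    Real.rpow_le_rpow hr.le (by linarith) hθ0
  have h2 : 0 ≤ (gdiam G : ℝ) ^ θ := by positivity
  linarith

lemma iso_dist (G : SimpleGraph V) (hG : G.Connected) (φ : G ≃g G) (x y : V) :
    G.dist (φ x) (φ y) = G.dist x y := by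
  have h : ∀ (ψ : G ≃g G) (x y : V), G.dist (ψ x) (ψ y) ≤ G.dist x y := by
    intro ψ x y
    obtain ⟨p, hp⟩ := hG.exists_walk_length_eq_dist x y
    have := SimpleGraph.dist_le (p.map ψ.toHom)
    rw [SimpleGraph.Walk.length_map, hp] at this
    exact this
  refine le_antisymm (h φ x y) ?_
  have := h φ.symm (φ x) (φ y)
  simpa using this

lemma ball_card (G : SimpleGraph V) (hG : G.Connected) (ht : ∀ x y : V, ∃ φ : G ≃g G, φ x = y)
    (x y : V) (r : ℝ) : (gball G x r).card = (gball G y r).card := by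
  obtain ⟨φ, rfl⟩ := ht x y
  refine Finset.card_bij (fun v _ => φ v) ?_ ?_ ?_
  · intro v hv
    rw [mem_gball] at *
    rwa [iso_dist G hG]
  · intro v _ w _ h
    exact φ.injective h
  · intro w hw
    refine ⟨φ.symm w, ?_, by simp⟩
    rw [mem_gball] at *
    rw [← iso_dist G hG φ]
    simpa using hw

lemma far_point (G : SimpleGraph V) (hG : G.Connected) (ht : ∀ x y : V, ∃ φ : G ≃g G, φ x = y)
    (x : V) : ∃ y, G.dist x y = gdiam G := by
  have hne : (Finset.univ : Finset V).Nonempty := ⟨x, Finset.mem_univ x⟩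
  obtain ⟨a, _, ha⟩ := Finset.exists_mem_eq_sup Finset.univ hne
    (fun x => Finset.univ.sup fun y => G.dist x y)
  obtain ⟨b, _, hb⟩ := Finset.exists_mem_eq_sup Finset.univ hne (fun y => G.dist a y)
  obtain ⟨φ, rfl⟩ := ht a x
  refine ⟨φ b, ?_⟩
  rw [iso_dist G hG]
  unfold gdiam
  rw [ha, hb]

lemma niceG (G : SimpleGraph V) (hG : G.Connected) (ht : ∀ x y : V, ∃ φ : G ≃g G, φ x = y)
    (hD : 1 ≤ gdiam G) :
    NiceG G (fun x y => if G.Adj x y then ((G.degree x : ℝ))⁻¹ else 0) := by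
  refine ⟨hG, ?_, ?_, ?_, ?_, ball_card G hG ht, far_point G hG ht⟩
  · intro x y
    obtain ⟨φ, rfl⟩ := ht x y
    have hdeg : G.degree (φ x) = G.degree x := SimpleGraph.Iso.degree_eq φ x
    by_cases h : G.Adj x (φ x)
    · simp only [if_pos h, if_pos h.symm, hdeg]
    · simp only [if_neg h, if_neg (fun h' : G.Adj (φ x) x => h h'.symm)]
  · intro x y
    split_ifs <;> positivity
  · intro x
    obtain ⟨y, hy⟩ := far_point G hG ht x
    obtain ⟨γ, h1, -⟩ := exists_geod G hG x y
    have h2 := h1 1 (by omega)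
    rw [SimpleGraph.dist_eq_one_iff_adj] at h2
    have hdeg : 0 < G.degree x := by
      rw [SimpleGraph.degree_pos_iff_exists_adj]
      exact ⟨_, h2⟩
    have hdeg' : (0 : ℝ) < G.degree x := by exact_mod_cast hdeg
    rw [← Finset.sum_filter, Finset.sum_const, nsmul_eq_mul]
    rw [← SimpleGraph.neighborFinset_eq_filter, SimpleGraph.card_neighborFinset_eq_degree]
    field_simp
  · intro x y h
    simp [h]

lemma trivial_case (G : SimpleGraph V) (hG : G.Connected) (hD : gdiam G = 0) (θ : ℝ)
    (hθ : 2 ≤ θ) (K : V → V → ℝ) (hK : ∀ x y, ¬ G.Adj x y → K x y = 0) (x : V) (c : ℝ)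
    (hc : 0 < c) :
    SS G θ x = 1 ∧ 1 ≤ relaxTime (lampK K) (fun _ => c) ∧
      relaxTime (lampK K) (fun _ => c) ≤ 1 := by
  have hall : ∀ y, y = x := by
    intro y
    have := dist_le_gdiam G y x
    rw [hD] at this
    exact hG.dist_eq_zero_iff.mp (by omega)
  have hK0 : ∀ v w, K v w = 0 := by
    intro v w
    apply hK
    rw [hall v, hall w]
    exact G.irrefl
  have hl : ∀ p q, lampK K p q = 0 := by
    intro p q
    unfold lampK
    simp [hK0]
  refine ⟨?_, ?_⟩
  · unfold SS
    rw [hD]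
    have hcard : Fintype.card V = 1 := Fintype.card_eq_one_iff.mpr ⟨x, hall⟩
    rw [Nat.cast_zero, Real.zero_rpow (by linarith), mul_zero, Nat.floor_zero]
    have : (Finset.Iic 0 : Finset ℕ) = {0} := by ext; simp
    rw [this, Finset.sum_singleton, Nat.cast_zero, Real.zero_rpow (by positivity),
      gball_zero G hG x 0 le_rfl one_pos, hcard]
    simp
  · refine relax_bounds (lampK K) c 1 1 hc one_pos ?_ ?_
    · intro F _
      simp only [hl, zero_mul, Finset.sum_const_zero, sub_zero, one_mul, pow_two]
      exact le_rfl
    · refine ⟨fun p => chi {x} p.1, ?_, ?_, ?_⟩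
      · rw [Fintype.sum_prod_type_right]
        simp [chi_single_sum]
      · refine Finset.sum_pos (fun p _ => ?_) ⟨(fun _ => true, x), Finset.mem_univ _⟩
        simp [chi, lsgn_sq]
      · simp only [hl, zero_mul, Finset.sum_const_zero, sub_zero, one_mul, pow_two]
        exact le_rfl

lemma main_case (G : SimpleGraph V) (K : V → V → ℝ) (hG : NiceG G K)
    (θ p0 CD CP C1 C2 ε : ℝ) (hθ : 2 ≤ θ) (hD : 1 ≤ gdiam G)
    (h : Harnack G K (fun _ => (Fintype.card V : ℝ)⁻¹) θ p0 CD CP C1 C2 ε) (x : V) (c : ℝ)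
    (hc : 0 < c) :
    (3 * C2 * CD ^ 3)⁻¹ * AA G θ x ≤ relaxTime (lampK K) (fun _ => c) ∧
      relaxTime (lampK K) (fun _ => c) ≤
        (2 * (2 * CP * 4 ^ θ + 6 * (2 ^ θ / p0 + 12 * CP * 3 ^ θ + CP * 4 ^ θ)) + 2 ^ θ) *
          AA G θ x := by
  obtain ⟨hp0, hCD, hCP, hC1, hC2, hε, hE, hVD, hPI, hCS⟩ := h
  set CU := 2 * CP * 4 ^ θ + 6 * (2 ^ θ / p0 + 12 * CP * 3 ^ θ + CP * 4 ^ θ) with hCU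
  have hCU0 : 0 < CU := by positivity
  set A := AA G θ x with hA
  have hN1 : (1 : ℝ) ≤ Fintype.card V := by
    exact_mod_cast Fintype.card_pos_iff.mpr ⟨x⟩
  have hA1 : 1 ≤ 2 ^ θ * A := by
    rw [aa_zero G hG.conn θ x] at hN1
    refine hN1.trans (mul_le_mul_of_nonneg_left (aa_le_AA G θ x 0 (by omega)) (by positivity))
  have h2θ : (0 : ℝ) < 2 ^ θ := by positivity
  have hA0 : 0 < A := by
    by_contra hh
    nlinarith
  have hAy : ∀ y, AA G θ y = A := by
    intro y
    rw [hA]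
    unfold AA aa
    refine Finset.sum_congr rfl fun k _ => ?_
    rw [hG.ball y x]
  have hdiag : ∀ v, K v v = 0 := fun v => hG.off v v G.irrefl
  have hT1 : 1 ≤ (2 * CU + 2 ^ θ) * A := by nlinarith [mul_pos hCU0 hA0]
  have hDir : ∀ (y : V) (g : V → ℝ), g y = 0 →
      ∑ v, g v ^ 2 ≤ (2 * CU + 2 ^ θ) * A * ∑ v, g v * (g v - ∑ w, K v w * g w) := by
    intro y g hg
    have h1 := upper_dir G K hG θ p0 CP hθ hp0 hCP hE hPI hD y g hg
    rw [hAy, ← hCU] at h1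
    rw [en_eq K hG.sym hG.row]
    have h2 := en_nonneg K hG.nonneg g
    have h3 : 0 ≤ 2 ^ θ * A * (en K g / 2) := by positivity
    linarith
  refine relax_bounds (lampK K) c _ _ hc (by linarith) ?_ ?_
  · refine lamp_poincare K hdiag _ hT1 hDir ?_
    intro f hf
    have h1 := hDir x (fun v => f v - f x) (by simp)
    rw [en_eq K hG.sym hG.row] at h1 ⊢
    have e : en K (fun v => f v - f x) = en K f := by
      unfold en
      refine Finset.sum_congr rfl fun v _ => Finset.sum_congr rfl fun w _ => by ring
    rw [e] at h1
    refine le_trans ?_ h1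
    have e2 : ∑ v, (f v - f x) ^ 2 = ∑ v, f v ^ 2 - 2 * f x * ∑ v, f v
        + Fintype.card V * f x ^ 2 := by
      rw [Finset.mul_sum, ← Finset.sum_sub_distrib]
      have : (Fintype.card V : ℝ) * f x ^ 2 = ∑ _v : V, f x ^ 2 := by simp
      rw [this, ← Finset.sum_add_distrib]
      refine Finset.sum_congr rfl fun v _ => by ring
    rw [e2, hf]
    have : 0 ≤ (Fintype.card V : ℝ) * f x ^ 2 := by positivity
    linarith
  · obtain ⟨g, hg0, hg1, hg2⟩ := lower_test G K hG θ CD C1 C2 ε hCD hC2 hVD hCS hD x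
    obtain ⟨F, hF1, hF2, hF3⟩ := lamp_test K hdiag x g hg0
    refine ⟨F, hF1, ?_, ?_⟩
    · rw [hF2]; positivity
    · rw [hF2, hF3, en_eq K hG.sym hG.row]
      have hκ : 0 < 3 * C2 * CD ^ 3 := by positivity
      rw [mul_left_comm]
      refine mul_le_mul_of_nonneg_left ?_ (by positivity)
      rw [mul_assoc, inv_mul_le_iff₀ hκ]
      exact hg2

lemma SS_nonneg (G : SimpleGraph V) (θ : ℝ) (x : V) : 0 ≤ SS G θ x :=
  Finset.sum_nonneg fun _ _ => div_nonneg (Nat.cast_nonneg _) (Nat.cast_nonneg _)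

lemma sup_eq_SS (G : SimpleGraph V) (hG : G.Connected)
    (ht : ∀ x y : V, ∃ φ : G ≃g G, φ x = y) (θ : ℝ) (x : V) :
    (⨆ y : V, ∑ n ∈ Finset.Iic ⌊2 * (gdiam G : ℝ) ^ θ⌋₊,
      1 / vol G (fun _ => (Fintype.card V : ℝ)⁻¹) y ((n : ℝ) ^ (1 / θ))) = SS G θ x := by
  have hy : ∀ y : V, ∑ n ∈ Finset.Iic ⌊2 * (gdiam G : ℝ) ^ θ⌋₊,
      1 / vol G (fun _ => (Fintype.card V : ℝ)⁻¹) y ((n : ℝ) ^ (1 / θ)) = SS G θ x := by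
    intro y
    unfold SS
    refine Finset.sum_congr rfl fun n _ => ?_
    rw [ball_card G hG ht x y]
    unfold vol
    rw [Finset.sum_const, nsmul_eq_mul]
    generalize (gball G y ((n : ℝ) ^ (1 / θ))).card = b
    rw [one_div, mul_inv, inv_inv, mul_comm, div_eq_mul_inv]
  have : Nonempty V := ⟨x⟩
  rw [iSup_congr hy]
  exact ciSup_const

/-- For a vertex-transitive Harnack graph `Γ`, the relaxation time of the
lamplighter walk on `ℤ₂ ≀ Γ` is comparable to `max_x ∑_{0 ≤ n ≤ 2D^θ} 1/V(x,n^{1/θ})`. -/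
theorem stmt18 (θ p0 CD CP Ccs1 Ccs2 ε : ℝ) (hθ : 2 ≤ θ) :
    ∃ c > (0 : ℝ), ∃ C > (0 : ℝ),
      ∀ (V : Type) [Fintype V] [DecidableEq V] (G : SimpleGraph V),
        G.Connected → (∀ x y : V, ∃ φ : G ≃g G, φ x = y) →
        ∀ K : V → V → ℝ,
          (K = fun x y => if G.Adj x y then ((G.degree x : ℝ))⁻¹ else 0) →
        ∀ pi : V → ℝ, (pi = fun _ => (Fintype.card V : ℝ)⁻¹) →
          Harnack G K pi θ p0 CD CP Ccs1 Ccs2 ε →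
          c * (⨆ x : V, ∑ n ∈ Finset.Iic ⌊2 * (gdiam G : ℝ) ^ θ⌋₊,
                  1 / vol G pi x ((n : ℝ) ^ (1 / θ))) ≤
              relaxTime (lampK K) (fun _ => (Fintype.card ((V → Bool) × V) : ℝ)⁻¹) ∧
            relaxTime (lampK K) (fun _ => (Fintype.card ((V → Bool) × V) : ℝ)⁻¹) ≤
              C * (⨆ x : V, ∑ n ∈ Finset.Iic ⌊2 * (gdiam G : ℝ) ^ θ⌋₊,
                  1 / vol G pi x ((n : ℝ) ^ (1 / θ))) := by
  by_cases hpos : 0 < p0 ∧ 0 < CD ∧ 0 < CP ∧ 0 < Ccs2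
  swap
  · refine ⟨1, one_pos, 1, one_pos, ?_⟩
    intro V _ _ G hG ht K hK pi hpi h
    exact absurd ⟨h.1, h.2.1, h.2.2.1, h.2.2.2.2.1⟩ hpos
  obtain ⟨hp0, hCD, hCP, hC2⟩ := hpos
  set κ : ℝ := 3 * Ccs2 * CD ^ 3 with hκ
  set m : ℝ := 2 * 4 ^ θ + 2 ^ θ with hm
  set M : ℝ := 2 * (2 * CP * 4 ^ θ + 6 * (2 ^ θ / p0 + 12 * CP * 3 ^ θ + CP * 4 ^ θ)) + 2 ^ θ
    with hM
  have hκ0 : 0 < κ := by positivity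
  have hm0 : 0 < m := by positivity
  have hM0 : 0 < M := by positivity
  refine ⟨min 1 (κ⁻¹ * m⁻¹), by positivity, max 1 (M * 4), by positivity, ?_⟩
  intro V _ _ G hG ht K hK pi hpi h
  subst hK hpi
  obtain ⟨x⟩ := hG.nonempty
  have hc : (0 : ℝ) < (Fintype.card ((V → Bool) × V) : ℝ)⁻¹ := by
    have : 0 < Fintype.card ((V → Bool) × V) :=
      Fintype.card_pos_iff.mpr ⟨(fun _ => true, x)⟩
    positivity
  rw [sup_eq_SS G hG ht θ x]
  have hSS0 : 0 ≤ SS G θ x := SS_nonneg G θ x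
  rcases Nat.eq_zero_or_pos (gdiam G) with h0 | h1
  · obtain ⟨e, a, b⟩ := trivial_case G hG h0 θ hθ
      (fun x y => if G.Adj x y then ((G.degree x : ℝ))⁻¹ else 0)
      (fun x y hxy => by simp [hxy]) x _ hc
    rw [e, mul_one, mul_one]
    exact ⟨(min_le_left _ _).trans a, b.trans (le_max_left _ _)⟩
  · obtain ⟨a, b⟩ := main_case G _ (niceG G hG ht h1) θ p0 CD CP Ccs1 Ccs2 ε hθ h1 h x _ hc
    have s1 := S_le_A G hG θ hθ x
    have s2 := A_le_S G hG θ hθ h1 x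
    refine ⟨?_, ?_⟩
    · refine le_trans ?_ a
      calc min 1 (κ⁻¹ * m⁻¹) * SS G θ x ≤ κ⁻¹ * m⁻¹ * SS G θ x :=
            mul_le_mul_of_nonneg_right (min_le_right _ _) hSS0
        _ = κ⁻¹ * (m⁻¹ * SS G θ x) := by ring
        _ ≤ κ⁻¹ * AA G θ x := by
            refine mul_le_mul_of_nonneg_left ?_ (by positivity)
            rw [inv_mul_le_iff₀ hm0]
            exact s1
    · refine b.trans ?_
      calc M * AA G θ x ≤ M * (4 * SS G θ x) := mul_le_mul_of_nonneg_left s2 hM0.le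
        _ = M * 4 * SS G θ x := by ring
        _ ≤ max 1 (M * 4) * SS G θ x := mul_le_mul_of_nonneg_right (le_max_right _ _) hSS0
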